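/- Let k be a field of positive characteristic p and R → S a surjection of graded k-algebras, with R a complete intersection (a quotient of a positively graded polynomial ring over k by a homogeneous regular sequence) and S artinian. Let e be a positive integer, q = p^e, and d_1 ≤ … ≤ d_ℓ the socle degrees of S. If the socle of F_R^e(S) has the same k-dimension ℓ as the socle of S and the socle degrees of F_R^e(S) are D_1 ≤ … ≤ D_ℓ with D_i = q·d_i − (q−1)·a(R) for all i, then Tor_1^R(S, ^{φ_R^e}R) = 0. -/

import Mathlib

open Finset CategoryTheory

section Prelim
variable {k : Type} [Field k] {R : Type} [CommRing R] [Algebra k R]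

/-- The irrelevant maximal ideal `m = ⊕_{i>0} R_i` of a graded algebra with pieces `𝒜`. -/
def irrel (𝒜 : ℕ → Submodule k R) : Ideal R :=
  Ideal.span {x : R | ∃ i, 0 < i ∧ x ∈ 𝒜 i}

/-- The degree-zero piece is exactly `k`. -/
def ZeroPieceIsBase (𝒜 : ℕ → Submodule k R) : Prop :=
  ∀ x ∈ 𝒜 0, ∃ c : k, c • (1 : R) = x

/-- The Frobenius power `I^{[q]}`, generated by the `q`-th powers of the elements of `I`. -/
def frobPow {R : Type} [CommRing R] (I : Ideal R) (q : ℕ) : Ideal R :=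
  Ideal.span ((fun x => x ^ q) '' (I : Set R))

/-- The `k`-dimension of the degree-`n` graded piece of the socle `(J : m)/J` of `R/J`. -/
noncomputable def socCount (𝒜 : ℕ → Submodule k R) (J : Ideal R) (n : ℕ) : ℕ :=
  Module.finrank k ((Submodule.restrictScalars k (J.colon (irrel 𝒜)) ⊓ 𝒜 n) : Submodule k R) -
    Module.finrank k ((Submodule.restrictScalars k J ⊓ 𝒜 n) : Submodule k R)

/-- The socle degrees of `R/J` are `d 0 ≤ … ≤ d (ℓ-1)`, as a multiset. -/
def HasSocleDegrees (𝒜 : ℕ → Submodule k R) (J : Ideal R) {ℓ : ℕ} (d : Fin ℓ → ℕ) : Prop :=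
  Monotone d ∧ ∀ n : ℕ, socCount 𝒜 J n = (univ.filter fun i => d i = n).card

/-- The Hilbert series of `R/J`. -/
noncomputable def hilbQ (𝒜 : ℕ → Submodule k R) (J : Ideal R) : PowerSeries ℤ :=
  PowerSeries.mk fun n =>
    (Module.finrank k ((𝒜 n : Submodule k R)) : ℤ) -
      (Module.finrank k ((Submodule.restrictScalars k J ⊓ 𝒜 n) : Submodule k R) : ℤ)

/-- `a` is the `a`-invariant of `R/J`: for a Cohen-Macaulay graded quotient this is
the degree of the Hilbert series of `R/J` as a rational function, which agrees with the
Goto-Watanabe `a`-invariant defined via graded local cohomology. -/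
def IsAInv (𝒜 : ℕ → Submodule k R) (J : Ideal R) (a : ℤ) : Prop :=
  ∃ num den : Polynomial ℤ, den ≠ 0 ∧
    (den : PowerSeries ℤ) * hilbQ 𝒜 J = (num : PowerSeries ℤ) ∧
    a = (num.natDegree : ℤ) - den.natDegree

/-- `R` is F-pure: if `x ∉ J` then `x^q ∉ J^{[q]}` for all `q = p^e`. -/
def IsFPureRing (R : Type) [CommRing R] (p : ℕ) : Prop :=
  ∀ (J : Ideal R) (x : R), x ∉ J → ∀ e : ℕ, x ^ p ^ e ∉ frobPow J (p ^ e)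

/-- A graded `k`-algebra is Cohen-Macaulay iff some homogeneous system of parameters is a
regular sequence. -/
def IsCMGraded (𝒜 : ℕ → Submodule k R) : Prop :=
  ∃ xs : List R, RingTheory.Sequence.IsRegular R xs ∧
    (∀ x ∈ xs, ∃ i, 0 < i ∧ x ∈ 𝒜 i) ∧
    (Ideal.span {x | x ∈ xs}).radical = irrel 𝒜

/-- A graded `k`-algebra is Gorenstein iff some homogeneous system of parameters is a
regular sequence and the (artinian) quotient by it has one-dimensional socle. -/
def IsGorensteinGraded (𝒜 : ℕ → Submodule k R) : Prop :=
  ∃ xs : List R, RingTheory.Sequence.IsRegular R xs ∧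
    (∀ x ∈ xs, ∃ i, 0 < i ∧ x ∈ 𝒜 i) ∧
    (Ideal.span {x | x ∈ xs}).radical = irrel 𝒜 ∧
    ∃ δ : ℕ, socCount 𝒜 (Ideal.span {x | x ∈ xs}) δ = 1 ∧
      ∀ n : ℕ, n ≠ δ → socCount 𝒜 (Ideal.span {x | x ∈ xs}) n = 0

/-- `x 0, …, x (ℓ-1)` is a minimal generating set for the submodule `N`. -/
def IsMinGenSet {R M : Type} [CommRing R] [AddCommGroup M] [Module R M] {ℓ : ℕ}
    (x : Fin ℓ → M) (N : Submodule R M) : Prop :=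
  Submodule.span R (Set.range x) = N ∧ ∀ i, x i ∉ Submodule.span R (x '' {j | j ≠ i})

/-- `Tor_n^R(M, N)`. -/
noncomputable def TorM (R : Type) [CommRing R] (n : ℕ) (M N : ModuleCat R) : ModuleCat R :=
  ((Tor (ModuleCat R) n).obj M).obj N

/-- `R` viewed as a module over itself via the `e`-th iterate of the Frobenius
endomorphism, i.e. `^{φ_R^e}R`. -/
noncomputable def frobMod (R : Type) [CommRing R] (p : ℕ) [ExpChar R p] (e : ℕ) : ModuleCat R :=
  (ModuleCat.restrictScalars (iterateFrobenius R p e)).obj (ModuleCat.of R R)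

/-- `M` has finite projective dimension over the graded algebra `R`: over a Noetherian
graded algebra with `R₀ = k` this is equivalent to the eventual vanishing of
`Tor_n^R(M, R/m)`, `m` the irrelevant maximal ideal. -/
def HasFinProjDim (𝒜 : ℕ → Submodule k R) (M : ModuleCat R) : Prop :=
  ∃ n : ℕ, ∀ m : ℕ, n ≤ m → Subsingleton (TorM R m M (ModuleCat.of R (R ⧸ irrel 𝒜)))

/-- The degree-`n` graded piece of the twisted graded free module `⊕_j R(-b j)`. -/
def freePiece (𝒬 : ℕ → Submodule k R) {m : ℕ} (b : Fin m → ℕ) (n : ℤ) :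
    Submodule k (Fin m → R) :=
  Submodule.pi Set.univ fun j =>
    if 0 ≤ n - (b j : ℤ) then 𝒬 (n - (b j : ℤ)).toNat else ⊥

/-- The data `(r, b, A)` is a minimal homogeneous free resolution of `R/J` of length `c`:
the `i`-th free module is `⊕_{j < r i} R(-b i j)`, and the differentials are given by the
homogeneous matrices `A i`, with entries in the irrelevant maximal ideal (minimality). -/
def IsMinGradedFreeResolution (𝒜 : ℕ → Submodule k R) (J : Ideal R) (c : ℕ)
    (r : ℕ → ℕ) (b : (i : ℕ) → Fin (r i) → ℕ)
    (A : (i : ℕ) → Matrix (Fin (r i)) (Fin (r (i + 1))) R) : Prop :=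
  r 0 = 1 ∧ (∀ j, b 0 j = 0) ∧ (∀ i, c < i → r i = 0) ∧ 0 < r c ∧
    (∀ i j l, A i j l ∈ 𝒜 (b (i + 1) l - b i j) ∧ (b (i + 1) l < b i j → A i j l = 0)) ∧
    (∀ i j l, A i j l ∈ irrel 𝒜) ∧
    (∀ i, Function.Exact (Matrix.mulVecLin (A (i + 1))) (Matrix.mulVecLin (A i))) ∧
    Function.Exact (Matrix.mulVecLin (A 0))
      ((J.mkQ).comp (∑ j : Fin (r 0), LinearMap.proj j))

end Prelim

/-- An ideal of a weighted polynomial ring is homogeneous iff it contains all the weighted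
homogeneous components of its elements. -/
def IsWHomogeneousIdeal {k σ : Type} [Field k] (w : σ → ℕ)
    (I : Ideal (MvPolynomial σ k)) : Prop :=
  ∀ x ∈ I, ∀ n : ℕ, MvPolynomial.weightedHomogeneousComponent w n x ∈ I


open TensorProduct in
lemma tor_chase {R : Type} [CommRing R] (J : Ideal R) {P2 P1 P0 N : Type}
    [AddCommGroup P2] [AddCommGroup P1] [AddCommGroup P0] [AddCommGroup N]
    [Module R P2] [Module R P1] [Module R P0] [Module R N]
    (d2 : P2 →ₗ[R] P1) (d1 : P1 →ₗ[R] P0) (π : P0 →ₗ[R] N)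
    (h21 : Function.Exact d2 d1) (h10 : Function.Exact d1 π) (hπ : Function.Surjective π)
    (h : Function.Injective (TensorProduct.lift (LinearMap.lsmul R N ∘ₗ J.subtype) :
      TensorProduct R J N →ₗ[R] N))
    (x : (R ⧸ J) ⊗[R] P1) (hx : d1.lTensor (R ⧸ J) x = 0) :
    ∃ y, d2.lTensor (R ⧸ J) y = x := by
  obtain ⟨p, rfl⟩ : ∃ p : P1, (1 : R ⧸ J) ⊗ₜ[R] p = x := by
    obtain ⟨p, hp⟩ := Submodule.Quotient.mk_surjective _ (quotTensorEquivQuotSMul P1 J x)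
    refine ⟨p, ?_⟩
    apply (quotTensorEquivQuotSMul P1 J).injective
    rw [← hp]
    exact quotTensorEquivQuotSMul_mk_one_tmul J p
  rw [LinearMap.lTensor_tmul] at hx
  have hx2 : d1 p ∈ J • (⊤ : Submodule R P0) := by
    have := congrArg (quotTensorEquivQuotSMul P0 J) hx
    rw [map_zero] at this
    have h2 := (quotTensorEquivQuotSMul_mk_one_tmul J (d1 p)).symm.trans this
    exact (Submodule.Quotient.mk_eq_zero _).1 h2
  have key : ∀ z : P0, z ∈ J • (⊤ : Submodule R P0) → ∃ t : J ⊗[R] P0,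
      TensorProduct.lift (LinearMap.lsmul R P0 ∘ₗ J.subtype) t = z := by
    intro z hz
    induction hz using Submodule.smul_induction_on' with
    | smul r hr n hn => exact ⟨⟨r, hr⟩ ⊗ₜ n, by simp⟩
    | add x hx y hy h1 h2 =>
      obtain ⟨a, ha⟩ := h1
      obtain ⟨b, hb⟩ := h2
      exact ⟨a + b, by rw [map_add, ha, hb]⟩
  obtain ⟨t, ht⟩ := key _ hx2
  have nat : ∀ {A B : Type} [AddCommGroup A] [AddCommGroup B] [Module R A] [Module R B]
      (g : A →ₗ[R] B) (t : J ⊗[R] A),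
      TensorProduct.lift (LinearMap.lsmul R B ∘ₗ J.subtype) (g.lTensor J t) =
      g (TensorProduct.lift (LinearMap.lsmul R A ∘ₗ J.subtype) t) := by
    intro A B _ _ _ _ g t
    induction t with
    | zero => simp
    | tmul a b => simp
    | add a b ha hb => simp only [map_add, ha, hb]
  have h0 : π.lTensor J t = 0 := by
    apply h
    rw [nat, ht, map_zero]
    exact h10.apply_apply_eq_zero p
  obtain ⟨s, hs⟩ := (lTensor_exact J h10 hπ t).1 h0
  have h3 : d1 (TensorProduct.lift (LinearMap.lsmul R P1 ∘ₗ J.subtype) s) = d1 p := by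
    rw [← nat, hs, ht]
  obtain ⟨y, hy⟩ := (h21 (p - TensorProduct.lift (LinearMap.lsmul R P1 ∘ₗ J.subtype) s)).1
    (by rw [map_sub, h3, sub_self])
  refine ⟨1 ⊗ₜ y, ?_⟩
  rw [LinearMap.lTensor_tmul, hy, tmul_sub]
  have : ∀ s : J ⊗[R] P1, (1 : R ⧸ J) ⊗ₜ[R] (TensorProduct.lift (LinearMap.lsmul R P1 ∘ₗ J.subtype) s) = 0 := by
    intro s
    induction s with
    | zero => simp
    | tmul a b =>
      simp only [TensorProduct.lift.tmul, LinearMap.comp_apply, LinearMap.lsmul_apply, Submodule.subtype_apply]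
      rw [← smul_tmul]
      have : (a : R) • (1 : R ⧸ J) = 0 := by
        rw [Algebra.smul_def, mul_one]
        exact Ideal.Quotient.eq_zero_iff_mem.2 a.2
      rw [this, zero_tmul]
    | add a b ha hb => rw [map_add, tmul_add, ha, hb, add_zero]
  rw [this, sub_zero]

lemma tor_one_subsingleton {R : Type} [CommRing R] (J : Ideal R) (N : ModuleCat.{0} R)
    (h : Function.Injective (TensorProduct.lift (LinearMap.lsmul R N ∘ₗ J.subtype) :
      TensorProduct R J N →ₗ[R] N)) :
    Subsingleton (TorM R 1 (ModuleCat.of R (R ⧸ J)) N) := by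
  unfold TorM
  let P := projectiveResolution N
  let F := ((MonoidalCategory.tensoringLeft (ModuleCat R)).obj (ModuleCat.of R (R ⧸ J)))
  have iso := P.isoLeftDerivedObj F 1
  rw [← ModuleCat.isZero_iff_subsingleton]
  refine Limits.IsZero.of_iso ?_ iso
  have hex : ((F.mapHomologicalComplex _).obj P.complex).ExactAt 1 := by
    rw [HomologicalComplex.exactAt_iff' _ 2 1 0 (by simp) (by simp)]
    rw [ShortComplex.moduleCat_exact_iff]
    intro x hx
    have e1 := (ShortComplex.ShortExact.moduleCat_exact_iff_function_exact _).1 (P.exact_succ 0)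
    have e0 := (ShortComplex.ShortExact.moduleCat_exact_iff_function_exact _).1 P.exact₀
    have hs : Function.Surjective (P.π.f 0) := (ModuleCat.epi_iff_surjective _).1 inferInstance
    exact tor_chase J (P.complex.d 2 1).hom (P.complex.d 1 0).hom (P.π.f 0).hom e1 e0 hs h x hx
  exact hex.isZero_homology


section Multi
variable {A ι : Type} [CommRing A] [Fintype ι]

lemma span_range_pow_eq (f : ι → A) (r : ℕ) :
    (Ideal.span (Set.range f)) ^ r =
      Ideal.span ((fun α : ι →₀ ℕ => ∏ i, f i ^ α i) '' {α | α.degree = r}) := by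
  have h1 : Ideal.span (Set.range f) =
      (MvPolynomial.idealOfVars ι A).map (MvPolynomial.aeval f : MvPolynomial ι A →ₐ[A] A) := by
    rw [MvPolynomial.idealOfVars, Ideal.map_span, ← Set.range_comp]
    congr 1
    ext x; simp
  rw [h1, ← Ideal.map_pow, MvPolynomial.pow_idealOfVars_eq_span, Ideal.map_span, ← Set.image_comp]
  congr 1
  ext x
  simp [MvPolynomial.eval_monomial, Finsupp.prod_fintype]

lemma mem_span_range_pow (f : ι → A) (r : ℕ) (x : A) (hx : x ∈ (Ideal.span (Set.range f)) ^ r) :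
    ∃ (s : Finset (ι →₀ ℕ)) (y : (ι →₀ ℕ) → A), (∀ α ∈ s, α.degree = r) ∧
      x = ∑ α ∈ s, y α * ∏ i, f i ^ α i := by
  rw [span_range_pow_eq, Ideal.span, Finsupp.mem_span_image_iff_linearCombination] at hx
  obtain ⟨l, hl, rfl⟩ := hx
  refine ⟨l.support, l, fun α hα => (Finsupp.mem_supported _ _).1 hl hα, ?_⟩
  rw [Finsupp.linearCombination_apply, Finsupp.sum]
  rfl

lemma prod_mem_pow (f : ι → A) (α : ι →₀ ℕ) :
    ∏ i, f i ^ α i ∈ (Ideal.span (Set.range f)) ^ α.degree := by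
  rw [span_range_pow_eq]
  exact Ideal.subset_span ⟨α, rfl, rfl⟩

lemma prod_mem_of_le (f : ι → A) (q : ℕ) (Q : Ideal A) (hQ : ∀ i, f i ^ q ∈ Q) (α : ι → ℕ)
    (i : ι) (hi : q ≤ α i) : ∏ i, f i ^ α i ∈ Q := by
  have h1 : f i ^ q ∣ ∏ i, f i ^ α i :=
    (pow_dvd_pow _ hi).trans (Finset.dvd_prod_of_mem (fun i => f i ^ α i) (Finset.mem_univ i))
  exact Q.mem_of_dvd h1 (hQ i)

lemma multi_core (f : ι → A) (q : ℕ) (hq : 0 < q) (Q : Ideal A) (hQ : ∀ i, f i ^ q ∈ Q) (r : ℕ)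
    (s : Finset (ι →₀ ℕ)) (y : (ι →₀ ℕ) → A) (hs : ∀ α ∈ s, α.degree = r)
    (β : ι →₀ ℕ) (hβ : β ∈ s) (hβq : ∀ i, β i < q) :
    (∏ i, f i ^ (q - 1 - β i)) * (∑ α ∈ s, y α * ∏ i, f i ^ α i) -
      (∏ i, f i ^ (q - 1)) * y β ∈ Q := by
  classical
  rw [Finset.mul_sum, ← Finset.add_sum_erase _ _ hβ]
  have h1 : (∏ i, f i ^ (q - 1 - β i)) * (y β * ∏ i, f i ^ β i) = (∏ i, f i ^ (q - 1)) * y β := by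
    rw [mul_left_comm, ← Finset.prod_mul_distrib, mul_comm]
    congr 1
    refine Finset.prod_congr rfl fun i _ => ?_
    rw [← pow_add]
    congr 1
    have := hβq i
    omega
  rw [h1, add_sub_cancel_left]
  refine Q.sum_mem fun α hα => ?_
  rw [mul_left_comm, ← Finset.prod_mul_distrib]
  refine Q.mul_mem_left _ ?_
  simp_rw [← pow_add]
  obtain ⟨hne, hαs⟩ := Finset.mem_erase.1 hα
  obtain ⟨i, hi⟩ : ∃ i, β i < α i := by
    by_contra! hcon
    apply hne
    have hd : α.degree = β.degree := (hs α hαs).trans (hs β hβ).symm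
    rw [Finsupp.degree_eq_sum, Finsupp.degree_eq_sum] at hd
    ext i
    exact (Finset.sum_eq_sum_iff_of_le (fun i _ => hcon i)).1 hd i (Finset.mem_univ i)
  refine prod_mem_of_le f q Q hQ (fun i => q - 1 - β i + α i) i ?_
  have := hβq i
  omega

/-- the descent step for lemma B -/
lemma lemB_step (f : ι → A) (q : ℕ) (hq : 0 < q) (Q : Ideal A) (hQ : ∀ i, f i ^ q ∈ Q)
    (hinj : ∀ y, (∏ i, f i ^ (q - 1)) * y ∈ Q → y ∈ Q ⊔ Ideal.span (Set.range f))
    (r : ℕ) (x : A) (hxQ : x ∈ Q) (hx : x ∈ (Ideal.span (Set.range f)) ^ (r + 1)) :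
    ∃ a ∈ (Ideal.span (Set.range f)) * Q ⊔ Ideal.span (Set.range fun i => f i ^ q),
      x - a ∈ Q ∧ x - a ∈ (Ideal.span (Set.range f)) ^ (r + 2) := by
  set C := Ideal.span (Set.range f) with hC
  set Cq := Ideal.span (Set.range fun i => f i ^ q) with hCq
  have hle : C * Q ⊔ Cq ≤ Q := by
    refine sup_le Ideal.mul_le_right ?_
    rw [hCq, Ideal.span_le]
    rintro _ ⟨i, rfl⟩
    exact hQ i
  suffices h : x ∈ (C * Q ⊔ Cq) ⊔ C ^ (r + 2) by
    obtain ⟨a, ha, b, hb, rfl⟩ := Submodule.mem_sup.1 h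
    refine ⟨a, ha, Q.sub_mem hxQ (hle ha), ?_⟩
    rwa [add_sub_cancel_left]
  obtain ⟨s, y, hs, hxs⟩ := mem_span_range_pow f _ x hx
  suffices h : ∑ α ∈ s, y α * ∏ i, f i ^ α i ∈ (C * Q ⊔ Cq) ⊔ C ^ (r + 2) by rwa [← hxs] at h
  refine Ideal.sum_mem _ fun β hβ => ?_
  by_cases hβq : ∀ i, β i < q
  · have h1 := multi_core f q hq Q hQ _ s y hs β hβ hβq
    rw [← hxs] at h1
    have h2 : (∏ i, f i ^ (q - 1)) * y β ∈ Q := by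
      have := Q.sub_mem (Q.mul_mem_left (∏ i, f i ^ (q - 1 - β i)) hxQ) h1
      rwa [sub_sub_cancel] at this
    obtain ⟨u, hu, v, hv, huv⟩ := Submodule.mem_sup.1 (hinj _ h2)
    have h3 := prod_mem_pow f β
    rw [hs β hβ] at h3
    rw [← huv, add_mul]
    refine Ideal.add_mem _ ?_ ?_
    · refine Ideal.mem_sup_left (Ideal.mem_sup_left ?_)
      rw [mul_comm u]
      exact Ideal.mul_mem_mul (Ideal.pow_le_self (by omega) h3) hu
    · refine Ideal.mem_sup_right ?_
      rw [show r + 2 = 1 + (r + 1) by omega, pow_add, pow_one]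
      exact Ideal.mul_mem_mul hv h3
  · push Not at hβq
    obtain ⟨i, hi⟩ := hβq
    refine Ideal.mem_sup_left (Ideal.mem_sup_right ?_)
    exact Ideal.mul_mem_left _ _
      (prod_mem_of_le f q Cq (fun i => Ideal.subset_span ⟨i, rfl⟩) β i hi)

lemma lemB (f : ι → A) (q : ℕ) (hq : 0 < q) (Q : Ideal A) (hQ : ∀ i, f i ^ q ∈ Q)
    (hinj : ∀ y, (∏ i, f i ^ (q - 1)) * y ∈ Q → y ∈ Q ⊔ Ideal.span (Set.range f))
    (x : A) (hxQ : x ∈ Q) (hx : x ∈ Ideal.span (Set.range f)) :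
    x ∈ (Ideal.span (Set.range f)) * Q ⊔ Ideal.span (Set.range fun i => f i ^ q) := by
  have h : ∀ r : ℕ, ∃ a ∈ (Ideal.span (Set.range f)) * Q ⊔ Ideal.span (Set.range fun i => f i ^ q),
      x - a ∈ Q ∧ x - a ∈ (Ideal.span (Set.range f)) ^ (r + 1) := by
    intro r
    induction r with
    | zero => exact ⟨0, Ideal.zero_mem _, by simpa using hxQ, by simpa using hx⟩
    | succ r ih =>
      obtain ⟨a, ha, h1, h2⟩ := ih
      obtain ⟨b, hb, h3, h4⟩ := lemB_step f q hq Q hQ hinj r _ h1 h2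
      exact ⟨a + b, Ideal.add_mem _ ha hb, by rwa [← sub_sub], by rwa [← sub_sub]⟩
  obtain ⟨a, ha, -, h2⟩ := h (Fintype.card ι * q)
  rw [← sub_add_cancel x a]
  refine Ideal.add_mem _ (Ideal.mem_sup_right ?_) ha
  obtain ⟨s, y, hs, hxs⟩ := mem_span_range_pow f _ _ h2
  rw [hxs]
  refine Ideal.sum_mem _ fun β hβ => Ideal.mul_mem_left _ _ ?_
  obtain ⟨i, hi⟩ : ∃ i, q ≤ β i := by
    by_contra! hcon
    have h5 := hs β hβ
    rw [Finsupp.degree_eq_sum] at h5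
    have : ∑ i, β i ≤ ∑ i : ι, q := Finset.sum_le_sum fun i _ => (hcon i).le
    simp at this
    omega
  exact prod_mem_of_le f q (Ideal.span (Set.range fun i => f i ^ q)) (fun i => Ideal.subset_span ⟨i, rfl⟩) β i hi

end Multi


section Cartier
variable {k : Type} [Field k] {σ : Type}

lemma exists_frob_basis (p : ℕ) [Fact p.Prime] [CharP k p] (e : ℕ) :
    ∃ (T : Type) (b : T → k) (lam : T → k →+ k),
      (∀ j a c, lam j (a ^ p ^ e * c) = a * lam j c) ∧
      (∀ c, ∃ s : Finset T, ∀ s', s ⊆ s' → c = ∑ j ∈ s', (lam j c) ^ p ^ e * b j) := by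
  let M : Module k k := Module.compHom k (iterateFrobenius k p e)
  have hM : ∀ a c : k, M.toSMul.smul a c = a ^ p ^ e * c := fun a c => by
    change iterateFrobenius k p e a * c = _
    rw [iterateFrobenius_def]
  let B := @Module.Basis.ofVectorSpace k k _ _ M
  refine ⟨_, B, fun j => AddMonoidHom.mk' (fun c => (@Module.Basis.repr _ k k _ _ M B c) j) ?_, ?_, ?_⟩
  · intro a c
    have := (@Module.Basis.repr _ k k _ _ M B).map_add a c
    rw [this]; rfl
  · intro j a c
    have := (@Module.Basis.repr _ k k _ _ M B).map_smul a c
    have h2 := (hM a c)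
    change (@Module.Basis.repr _ k k _ _ M B (a ^ p ^ e * c)) j = _
    rw [← h2]
    exact congrArg (fun z => z j) this
  · intro c
    refine ⟨(@Module.Basis.repr _ k k _ _ M B c).support, fun s' hs' => ?_⟩
    have h1 := @Module.Basis.linearCombination_repr _ k k _ _ M B c
    rw [Finsupp.linearCombination_apply, Finsupp.sum] at h1
    have h2 : ∀ j, M.toSMul.smul ((@Module.Basis.repr _ k k _ _ M B c) j) (B j) =
      ((@Module.Basis.repr _ k k _ _ M B c) j) ^ p ^ e * B j := fun j => hM _ _
    have h3 : ∑ j ∈ (@Module.Basis.repr _ k k _ _ M B c).support,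
      ((@Module.Basis.repr _ k k _ _ M B c) j) ^ p ^ e * B j = c := by
        refine Eq.trans ?_ h1
        exact Finset.sum_congr rfl fun j _ => (h2 j).symm
    refine Eq.trans h3.symm (Finset.sum_subset hs' fun j _ hj => ?_)
    rw [Finsupp.notMem_support_iff] at hj
    have hp : p ^ e ≠ 0 := pow_ne_zero _ (Fact.out : p.Prime).ne_zero
    rw [hj, zero_pow hp, zero_mul]

open Classical in
/-- A Cartier type operator. -/
noncomputable def cart (q : ℕ) (α : σ →₀ ℕ) (lam : k →+ k) :
    MvPolynomial σ k →+ MvPolynomial σ k :=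
  (Finsupp.liftAddHom (fun β : σ →₀ ℕ =>
    if β.mapRange (· % q) (Nat.zero_mod q) = α then
      (MvPolynomial.monomial (R := k) (β.mapRange (· / q) (Nat.zero_div q))).toAddMonoidHom.comp lam
    else 0)).comp AddMonoidAlgebra.coeffAddEquiv.toAddMonoidHom

open Classical in
lemma cart_monomial (q : ℕ) (α : σ →₀ ℕ) (lam : k →+ k) (β : σ →₀ ℕ) (c : k) :
    cart q α lam (MvPolynomial.monomial β c) =
      if β.mapRange (· % q) (Nat.zero_mod q) = α then
        MvPolynomial.monomial (β.mapRange (· / q) (Nat.zero_div q)) (lam c) else 0 := by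
  have h : cart q α lam (MvPolynomial.monomial β c) = (if β.mapRange (· % q) (Nat.zero_mod q) = α then
      (MvPolynomial.monomial (R := k) (β.mapRange (· / q) (Nat.zero_div q))).toAddMonoidHom.comp lam
    else 0) c := by
    unfold cart
    refine Eq.trans ?_ (Finsupp.liftAddHom_apply_single (fun β : σ →₀ ℕ =>
      if β.mapRange (· % q) (Nat.zero_mod q) = α then
      (MvPolynomial.monomial (R := k) (β.mapRange (· / q) (Nat.zero_div q))).toAddMonoidHom.comp lam
      else 0) β c)
    rfl
  rw [h]
  split_ifs <;> simp

lemma cart_pow_mul (p : ℕ) [Fact p.Prime] [CharP k p] (e : ℕ) (α : σ →₀ ℕ) (lam : k →+ k)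
    (hlam : ∀ a c, lam (a ^ p ^ e * c) = a * lam c) (g h : MvPolynomial σ k) :
    cart (p ^ e) α lam (g ^ p ^ e * h) = g * cart (p ^ e) α lam h := by
  classical
  have hp : 0 < p ^ e := pow_pos (Fact.out : p.Prime).pos _
  induction g using MvPolynomial.induction_on' with
  | add g1 g2 h1 h2 => rw [add_pow_char_pow, add_mul, map_add, h1, h2, add_mul]
  | monomial γ a =>
    induction h using MvPolynomial.induction_on' with
    | add a1 a2 h1 h2 => rw [mul_add, map_add, h1, h2, map_add, mul_add]
    | monomial β c =>
      rw [MvPolynomial.monomial_pow, MvPolynomial.monomial_mul, cart_monomial, cart_monomial, hlam]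
      have e1 : (p ^ e • γ + β).mapRange (· % p ^ e) (Nat.zero_mod _) =
        β.mapRange (· % p ^ e) (Nat.zero_mod _) := by
        ext i; simp
      have e2 : (p ^ e • γ + β).mapRange (· / p ^ e) (Nat.zero_div _) =
        γ + β.mapRange (· / p ^ e) (Nat.zero_div _) := by
        ext i; simp [Nat.mul_add_div hp]
      rw [e1, e2]
      split_ifs
      · rw [MvPolynomial.monomial_mul]
      · rw [mul_zero]

lemma exists_decomp [Fintype σ] (p : ℕ) [Fact p.Prime] [CharP k p] (e : ℕ)
    {T : Type} (b : T → k) (lam : T → k →+ k)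
    (hb : ∀ c, ∃ s : Finset T, ∀ s', s ⊆ s' → c = ∑ j ∈ s', (lam j c) ^ p ^ e * b j)
    (r : MvPolynomial σ k) :
    ∃ s : Finset (T × (σ →₀ ℕ)), ∀ s', s ⊆ s' →
      r = ∑ t ∈ s', (cart (p ^ e) t.2 (lam t.1) r) ^ p ^ e * MvPolynomial.monomial t.2 (b t.1) := by
  classical
  have hp : p ^ e ≠ 0 := pow_ne_zero _ (Fact.out : p.Prime).ne_zero
  induction r using MvPolynomial.induction_on' with
  | add r1 r2 h1 h2 =>
    obtain ⟨s1, h1⟩ := h1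
    obtain ⟨s2, h2⟩ := h2
    refine ⟨s1 ∪ s2, fun s' hs' => ?_⟩
    conv_lhs => rw [h1 s' (Finset.union_subset_left hs'), h2 s' (Finset.union_subset_right hs')]
    rw [← Finset.sum_add_distrib]
    refine Finset.sum_congr rfl fun t _ => ?_
    rw [map_add, add_pow_char_pow, add_mul]
  | monomial β c =>
    obtain ⟨s, hs⟩ := hb c
    set α := β.mapRange (· % p ^ e) (Nat.zero_mod _) with hα
    refine ⟨s ×ˢ {α}, fun s' hs' => ?_⟩
    have h1 : ∀ t : T × (σ →₀ ℕ), (cart (p ^ e) t.2 (lam t.1) (MvPolynomial.monomial β c)) ^ p ^ e *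
        MvPolynomial.monomial t.2 (b t.1) =
        if α = t.2 then MvPolynomial.monomial β ((lam t.1 c) ^ p ^ e * b t.1) else 0 := by
      rintro ⟨j, α'⟩
      dsimp only
      rw [cart_monomial]
      split_ifs with h
      · rw [MvPolynomial.monomial_pow, MvPolynomial.monomial_mul]
        congr 2
        rw [← h]
        ext i
        simp [Nat.div_add_mod]
      · rw [zero_pow hp, zero_mul]
    simp_rw [h1]
    rw [← Finset.sum_filter, ← map_sum]
    have h2 : ∑ t ∈ s' with α = t.2, (lam t.1 c) ^ p ^ e * b t.1 =
        ∑ j ∈ (s'.filter (fun t => α = t.2)).image Prod.fst, (lam j c) ^ p ^ e * b j := by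
      rw [Finset.sum_image]
      rintro ⟨x1, x2⟩ hx ⟨y1, y2⟩ hy hxy
      have hx' := (Finset.mem_filter.1 hx).2
      have hy' := (Finset.mem_filter.1 hy).2
      dsimp only at hxy hx' hy'
      rw [← hx', ← hy', hxy]
    rw [h2, ← hs]
    intro j hj
    rw [Finset.mem_image]
    exact ⟨(j, α), Finset.mem_filter.2 ⟨hs' (by simp [hj]), rfl⟩, rfl⟩

lemma frob_trivial_relation [Fintype σ] (p : ℕ) [Fact p.Prime] [CharP k p] (e : ℕ)
    {ι : Type} (S : Finset ι) (r J : ι → MvPolynomial σ k) (h : ∑ i ∈ S, r i * J i ^ p ^ e = 0) :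
    ∃ (T : Type) (s : Finset T) (b : T → MvPolynomial σ k) (ρ : T → ι → MvPolynomial σ k),
      (∀ i ∈ S, r i = ∑ t ∈ s, (ρ t i) ^ p ^ e * b t) ∧ ∀ t ∈ s, ∑ i ∈ S, ρ t i * J i = 0 := by
  classical
  obtain ⟨T, b, lam, hlam, hb⟩ := exists_frob_basis (k := k) p e
  choose s hs using fun i => exists_decomp p e b lam hb (r i)
  refine ⟨T × (σ →₀ ℕ), S.biUnion s, fun t => MvPolynomial.monomial t.2 (b t.1),
    fun t i => cart (p ^ e) t.2 (lam t.1) (r i), fun i hi => ?_, fun t _ => ?_⟩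
  · exact hs i _ (Finset.subset_biUnion_of_mem s hi)
  · have := congrArg (cart (p ^ e) t.2 (lam t.1)) h
    rw [map_zero, map_sum] at this
    rw [← this]
    refine Finset.sum_congr rfl fun i _ => ?_
    rw [mul_comm (r i), cart_pow_mul p e _ _ (hlam _), mul_comm]

end Cartier


section TorFinal
variable {k : Type} [Field k] {σ : Type} [Fintype σ]
open TensorProduct

/-- the pure tensor of the classes -/
noncomputable def tauT (p : ℕ) [Fact p.Prime] (e : ℕ) (C : Ideal (MvPolynomial σ k))
    [CharP (MvPolynomial σ k ⧸ C) p] (I : Ideal (MvPolynomial σ k)) (h : I) (r : MvPolynomial σ k) :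
    (I.map (Ideal.Quotient.mk C)) ⊗[MvPolynomial σ k ⧸ C] (frobMod (MvPolynomial σ k ⧸ C) p e) :=
  (⟨Ideal.Quotient.mk C h, Ideal.mem_map_of_mem _ h.2⟩ : I.map (Ideal.Quotient.mk C)) ⊗ₜ
    (show (frobMod (MvPolynomial σ k ⧸ C) p e) from (Ideal.Quotient.mk C r))

variable (p : ℕ) [Fact p.Prime] [CharP k p] (e : ℕ) (C : Ideal (MvPolynomial σ k))
    [CharP (MvPolynomial σ k ⧸ C) p] (I : Ideal (MvPolynomial σ k))

lemma frobMod_smul {R : Type} [CommRing R] (p : ℕ) [ExpChar R p] (e : ℕ) (a b : R) :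
    (a • (show frobMod R p e from b) : frobMod R p e) = (show frobMod R p e from a ^ p ^ e * b) := by
  change iterateFrobenius R p e a * b = _
  rw [iterateFrobenius_def]

lemma tauT_add_right (h : I) (r s : MvPolynomial σ k) :
    tauT p e C I h (r + s) = tauT p e C I h r + tauT p e C I h s := by
  unfold tauT
  rw [← tmul_add]
  congr 1

lemma tauT_zero_of_mem (h : I) (r : MvPolynomial σ k) (hr : r ∈ C) : tauT p e C I h r = 0 := by
  unfold tauT
  have : (Ideal.Quotient.mk C r) = 0 := Ideal.Quotient.eq_zero_iff_mem.2 hr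
  rw [this]
  exact tmul_zero _ _

lemma tauT_zero_of_mem_left (h : I) (r : MvPolynomial σ k) (hr : (h : MvPolynomial σ k) ∈ C) :
    tauT p e C I h r = 0 := by
  unfold tauT
  have : (⟨Ideal.Quotient.mk C h, Ideal.mem_map_of_mem _ h.2⟩ : I.map (Ideal.Quotient.mk C)) = 0 :=
    Subtype.ext (Ideal.Quotient.eq_zero_iff_mem.2 hr)
  rw [this]
  exact zero_tmul _ _

lemma tauT_neg_right (h : I) (r : MvPolynomial σ k) :
    tauT p e C I h (-r) + tauT p e C I h r = 0 := by
  rw [← tauT_add_right, neg_add_cancel]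
  exact tauT_zero_of_mem p e C I h 0 C.zero_mem

lemma tauT_add_left (h h' : I) (r : MvPolynomial σ k) :
    tauT p e C I (h + h') r = tauT p e C I h r + tauT p e C I h' r := by
  unfold tauT
  rw [← add_tmul]
  congr 1

lemma tauT_smul (h : I) (ρ b : MvPolynomial σ k) :
    tauT p e C I h (ρ ^ p ^ e * b) = tauT p e C I (ρ • h) b := by
  unfold tauT
  have h1 := frobMod_smul p e (Ideal.Quotient.mk C ρ) (Ideal.Quotient.mk C b)
  have h2 : (show frobMod (MvPolynomial σ k ⧸ C) p e from Ideal.Quotient.mk C (ρ ^ p ^ e * b)) =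
    (Ideal.Quotient.mk C ρ) • (show frobMod (MvPolynomial σ k ⧸ C) p e from Ideal.Quotient.mk C b) := by
    rw [h1, map_mul, map_pow]
  refine (congrArg _ h2).trans ?_
  rw [← smul_tmul]
  congr 1

lemma tauT_sum_right {T : Type} (s : Finset T) (h : I) (r : T → MvPolynomial σ k) :
    tauT p e C I h (∑ t ∈ s, r t) = ∑ t ∈ s, tauT p e C I h (r t) :=
  map_sum (AddMonoidHom.mk' (tauT p e C I h) (tauT_add_right p e C I h)) r s

lemma tauT_sum_left {T : Type} (s : Finset T) (h : T → I) (r : MvPolynomial σ k) :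
    tauT p e C I (∑ t ∈ s, h t) r = ∑ t ∈ s, tauT p e C I (h t) r :=
  map_sum (AddMonoidHom.mk' (fun h => tauT p e C I h r) (fun a b => tauT_add_left p e C I a b r)) h s

lemma tauT_relation {n : ℕ} (h : Fin n → I) (r : Fin n → MvPolynomial σ k)
    (hr : ∑ i, r i * (h i : MvPolynomial σ k) ^ p ^ e = 0) : ∑ i, tauT p e C I (h i) (r i) = 0 := by
  obtain ⟨T, s, b, ρ, h1, h2⟩ := frob_trivial_relation p e Finset.univ r (fun i => (h i : MvPolynomial σ k)) hr
  have : ∀ i, tauT p e C I (h i) (r i) = ∑ t ∈ s, tauT p e C I (ρ t i • h i) (b t) := by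
    intro i
    rw [h1 i (Finset.mem_univ i), tauT_sum_right]
    exact Finset.sum_congr rfl fun t _ => tauT_smul p e C I _ _ _
  simp_rw [this]
  rw [Finset.sum_comm]
  refine Finset.sum_eq_zero fun t ht => ?_
  rw [← tauT_sum_left]
  apply tauT_zero_of_mem_left
  have := h2 t ht
  have h3 : ((∑ i, ρ t i • h i : I) : MvPolynomial σ k) = ∑ i, ρ t i * (h i : MvPolynomial σ k) := by
    simp
  rw [h3, this]
  exact C.zero_mem

lemma tauT_relation_list (L : List (I × MvPolynomial σ k))
    (hr : (L.map (fun a => a.2 * (a.1 : MvPolynomial σ k) ^ p ^ e)).sum = 0) :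
    (L.map (fun a => tauT p e C I a.1 a.2)).sum = 0 := by
  have := tauT_relation p e C I (fun i : Fin L.length => (L[i]).1) (fun i => (L[i]).2)
  rw [← Fin.sum_univ_fun_getElem] at hr
  rw [← Fin.sum_univ_fun_getElem]
  exact this hr

lemma tor_inj {c : ℕ} (f : Fin c → MvPolynomial σ k) (hC : C = Ideal.span (Set.range f))
    (hCI : C ≤ I)
    (hB : ∀ x ∈ frobPow I (p ^ e), x ∈ C →
      x ∈ C * frobPow I (p ^ e) ⊔ Ideal.span (Set.range fun i => f i ^ p ^ e)) :
    Function.Injective (TensorProduct.lift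
      (LinearMap.lsmul (MvPolynomial σ k ⧸ C) (frobMod (MvPolynomial σ k ⧸ C) p e) ∘ₗ
        (I.map (Ideal.Quotient.mk C)).subtype)) := by
  have hfC : ∀ i, f i ∈ C := fun i => by rw [hC]; exact Ideal.subset_span ⟨i, rfl⟩
  rw [injective_iff_map_eq_zero]
  intro t ht
  -- represent `t`
  have rep : ∀ t : (I.map (Ideal.Quotient.mk C)) ⊗[MvPolynomial σ k ⧸ C] (frobMod (MvPolynomial σ k ⧸ C) p e),
      ∃ L : List (I × MvPolynomial σ k), t = (L.map (fun a => tauT p e C I a.1 a.2)).sum := by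
    intro t
    induction t with
    | zero => exact ⟨[], by simp⟩
    | add a b ha hb =>
      obtain ⟨L, rfl⟩ := ha
      obtain ⟨L', rfl⟩ := hb
      exact ⟨L ++ L', by simp⟩
    | tmul j n =>
      obtain ⟨j, hj⟩ := j
      obtain ⟨i, hi, rfl⟩ := (Ideal.mem_map_iff_of_surjective _ Ideal.Quotient.mk_surjective).1 hj
      obtain ⟨r, hr⟩ := Ideal.Quotient.mk_surjective (I := C) n
      refine ⟨[(⟨i, hi⟩, r)], ?_⟩
      simp only [List.map_cons, List.map_nil, List.sum_cons, List.sum_nil, add_zero]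
      unfold tauT
      rw [hr]
  obtain ⟨L, rfl⟩ := rep t
  have im : ∀ L : List (I × MvPolynomial σ k), TensorProduct.lift
      (LinearMap.lsmul (MvPolynomial σ k ⧸ C) (frobMod (MvPolynomial σ k ⧸ C) p e) ∘ₗ
        (I.map (Ideal.Quotient.mk C)).subtype) (L.map (fun a => tauT p e C I a.1 a.2)).sum =
      (show frobMod (MvPolynomial σ k ⧸ C) p e from
        Ideal.Quotient.mk C (L.map (fun a => a.2 * (a.1 : MvPolynomial σ k) ^ p ^ e)).sum) := by
    intro L
    induction L with
    | nil => simp; rfl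
    | cons a L ih =>
      rw [List.map_cons, List.sum_cons, map_add, ih, List.map_cons, List.sum_cons, map_add]
      have : TensorProduct.lift
        (LinearMap.lsmul (MvPolynomial σ k ⧸ C) (frobMod (MvPolynomial σ k ⧸ C) p e) ∘ₗ
        (I.map (Ideal.Quotient.mk C)).subtype) (tauT p e C I a.1 a.2) =
        (show frobMod (MvPolynomial σ k ⧸ C) p e from
          Ideal.Quotient.mk C (a.2 * (a.1 : MvPolynomial σ k) ^ p ^ e)) := by
        unfold tauT
        rw [TensorProduct.lift.tmul]
        refine (frobMod_smul p e (Ideal.Quotient.mk C (a.1 : MvPolynomial σ k)) (Ideal.Quotient.mk C a.2)).trans ?_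
        rw [mul_comm a.2, map_mul, map_pow]
      rw [this]
      rfl
  rw [im] at ht
  have hxC : (L.map (fun a => a.2 * (a.1 : MvPolynomial σ k) ^ p ^ e)).sum ∈ C :=
    Ideal.Quotient.eq_zero_iff_mem.1 ht
  have hxQ : (L.map (fun a => a.2 * (a.1 : MvPolynomial σ k) ^ p ^ e)).sum ∈ frobPow I (p ^ e) := by
    refine list_sum_mem ?_
    intro x hx
    obtain ⟨a, -, rfl⟩ := List.mem_map.1 hx
    exact Ideal.mul_mem_left _ _ (Ideal.subset_span ⟨a.1, a.1.2, rfl⟩)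
  have rep2 : ∀ x ∈ C * frobPow I (p ^ e) ⊔ Ideal.span (Set.range fun i => f i ^ p ^ e),
      ∃ L : List (I × MvPolynomial σ k),
        (L.map (fun a => a.2 * (a.1 : MvPolynomial σ k) ^ p ^ e)).sum = x ∧
        (L.map (fun a => tauT p e C I a.1 a.2)).sum = 0 := by
    have addc : ∀ x y, (∃ L : List (I × MvPolynomial σ k),
        (L.map (fun a => a.2 * (a.1 : MvPolynomial σ k) ^ p ^ e)).sum = x ∧
        (L.map (fun a => tauT p e C I a.1 a.2)).sum = 0) → (∃ L : List (I × MvPolynomial σ k),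
        (L.map (fun a => a.2 * (a.1 : MvPolynomial σ k) ^ p ^ e)).sum = y ∧
        (L.map (fun a => tauT p e C I a.1 a.2)).sum = 0) → (∃ L : List (I × MvPolynomial σ k),
        (L.map (fun a => a.2 * (a.1 : MvPolynomial σ k) ^ p ^ e)).sum = x + y ∧
        (L.map (fun a => tauT p e C I a.1 a.2)).sum = 0) := by
      rintro x y ⟨L, h1, h2⟩ ⟨L', h1', h2'⟩
      exact ⟨L ++ L', by simp [h1, h1'], by simp [h2, h2']⟩
    intro x hx
    obtain ⟨y, hy, z, hz, rfl⟩ := Submodule.mem_sup.1 hx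
    clear hx
    apply addc
    · induction hy using Submodule.mul_induction_on' with
      | add x _ y _ h1 h2 => exact addc _ _ h1 h2
      | mem_mul_mem m hm n hn =>
        unfold frobPow at hn
        induction hn using Submodule.span_induction generalizing m with
        | mem x hx =>
          obtain ⟨h, hh, rfl⟩ := hx
          exact ⟨[(⟨h, hh⟩, m)], by simp, by simpa using tauT_zero_of_mem p e C I ⟨h, hh⟩ m hm⟩
        | zero => exact ⟨[], by simp, by simp⟩
        | add x y _ _ h1 h2 => rw [mul_add]; exact addc _ _ (h1 m hm) (h2 m hm)
        | smul a x _ h1 =>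
          rw [smul_eq_mul, ← mul_assoc]
          exact h1 (m * a) (C.mul_mem_right _ hm)
    · obtain ⟨y, hy⟩ := Ideal.mem_span_range_iff_exists_fun.1 hz
      rw [← hy]
      clear hy
      induction (Finset.univ : Finset (Fin c)) using Finset.induction_on with
      | empty => exact ⟨[], by simp, by simp⟩
      | insert i s his ih =>
        rw [Finset.sum_insert his]
        refine addc _ _ ⟨[(⟨f i, hCI (hfC i)⟩, y i)], by simp, ?_⟩ ih
        simpa using tauT_zero_of_mem_left p e C I ⟨f i, hCI (hfC i)⟩ (y i) (hfC i)
  obtain ⟨L', h1, h2⟩ := rep2 _ (hB _ hxQ hxC)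
  have h3 := tauT_relation_list p e C I (L ++ L'.map (fun a : I × MvPolynomial σ k => (a.1, -a.2))) (by
    rw [List.map_append, List.sum_append, ← h1, List.map_map]
    have : ((fun a : I × MvPolynomial σ k => a.2 * (a.1 : MvPolynomial σ k) ^ p ^ e) ∘
        fun a : I × MvPolynomial σ k => (a.1, -a.2)) =
      fun a => -(a.2 * (a.1 : MvPolynomial σ k) ^ p ^ e) := by
      ext a; simp
    rw [this]
    have hn : ∀ M : List (I × MvPolynomial σ k),
        (M.map (fun a => a.2 * (a.1 : MvPolynomial σ k) ^ p ^ e)).sum +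
        (M.map (fun a => -(a.2 * (a.1 : MvPolynomial σ k) ^ p ^ e))).sum = 0 := by
      intro M
      induction M with
      | nil => simp
      | cons a M ih =>
        simp only [List.map_cons, List.sum_cons]
        rw [add_add_add_comm, ih, add_neg_cancel, add_zero]
    exact hn L')
  rw [List.map_append, List.sum_append] at h3
  have h4 : ∀ M : List (I × MvPolynomial σ k),
      ((M.map (fun a : I × MvPolynomial σ k => (a.1, -a.2))).map (fun a => tauT p e C I a.1 a.2)).sum +
      (M.map (fun a => tauT p e C I a.1 a.2)).sum = 0 := by
    intro M
    induction M with
    | nil => simp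
    | cons a M ih =>
      simp only [List.map_cons, List.sum_cons]
      rw [add_add_add_comm, ih, tauT_neg_right, add_zero]
  have h5 := h4 L'
  rw [h2, add_zero] at h5
  rw [h5, add_zero] at h3
  exact h3

end TorFinal


section Homog
variable {k : Type} [Field k] {σ : Type}

lemma whc_sum (w : σ → ℕ) (x : MvPolynomial σ k) :
    ∃ s : Finset ℕ, x = ∑ n ∈ s, MvPolynomial.weightedHomogeneousComponent w n x := by
  refine ⟨(MvPolynomial.weightedHomogeneousComponent_finsupp (w := w) x).toFinset, ?_⟩
  rw [← finsum_eq_sum _ (MvPolynomial.weightedHomogeneousComponent_finsupp (w := w) x)]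
  exact (MvPolynomial.finsum_weightedHomogeneousComponent w x).symm

lemma whc_mul (w : σ → ℕ) (g : MvPolynomial σ k) (d : ℕ)
    (hg : g ∈ MvPolynomial.weightedHomogeneousSubmodule k w d) (y : MvPolynomial σ k) (N : ℕ) :
    ∃ y' ∈ MvPolynomial.weightedHomogeneousSubmodule k w (N - d), (d ≤ N ∨ y' = 0) ∧
      MvPolynomial.weightedHomogeneousComponent w N (y * g) = y' * g := by
  have key : ∀ (s : Finset ℕ) (z : ℕ → MvPolynomial σ k),
      (∀ n, z n ∈ MvPolynomial.weightedHomogeneousSubmodule k w n) →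
      ∃ y' ∈ MvPolynomial.weightedHomogeneousSubmodule k w (N - d), (d ≤ N ∨ y' = 0) ∧
      MvPolynomial.weightedHomogeneousComponent w N ((∑ n ∈ s, z n) * g) = y' * g := by
    intro s z hz
    rw [Finset.sum_mul, map_sum]
    induction s using Finset.induction_on with
    | empty => exact ⟨0, Submodule.zero_mem _, Or.inr rfl, by simp⟩
    | insert n s hn ih =>
      obtain ⟨y', h1, h2, h3⟩ := ih
      rw [Finset.sum_insert hn, h3]
      have hm : z n * g ∈ MvPolynomial.weightedHomogeneousSubmodule k w (n + d) :=
        MvPolynomial.IsWeightedHomogeneous.mul (hz n) hg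
      rw [MvPolynomial.weightedHomogeneousComponent_of_mem hm]
      by_cases h : N = n + d
      · rw [if_pos h]
        refine ⟨z n + y', Submodule.add_mem _ ?_ h1, Or.inl (by omega), by ring⟩
        have : N - d = n := by omega
        rw [this]; exact hz n
      · rw [if_neg h]
        exact ⟨y', h1, h2, by ring⟩
  obtain ⟨s, hs⟩ := whc_sum w y
  obtain ⟨y', h1, h2, h3⟩ := key s (fun n => MvPolynomial.weightedHomogeneousComponent w n y)
    (fun n => MvPolynomial.weightedHomogeneousComponent_mem w y n)
  rw [← hs] at h3
  exact ⟨y', h1, h2, h3⟩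

lemma whom_span (w : σ → ℕ) (S : Set (MvPolynomial σ k))
    (hS : ∀ g ∈ S, ∃ d, g ∈ MvPolynomial.weightedHomogeneousSubmodule k w d) :
    IsWHomogeneousIdeal w (Ideal.span S) := by
  intro x hx n
  obtain ⟨a, t, hsub, ht⟩ := (Submodule.mem_span_iff_exists_finset_subset).1 hx
  rw [← ht.2, map_sum]
  refine Ideal.sum_mem _ fun g hg => ?_
  obtain ⟨d, hd⟩ := hS g (hsub hg)
  obtain ⟨y', h1, h2, h3⟩ := whc_mul w g d hd (a g) n
  rw [smul_eq_mul, h3]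
  exact Ideal.mul_mem_left _ _ (Ideal.subset_span (hsub hg))

lemma whom_sup (w : σ → ℕ) (I J : Ideal (MvPolynomial σ k)) (hI : IsWHomogeneousIdeal w I)
    (hJ : IsWHomogeneousIdeal w J) : IsWHomogeneousIdeal w (I ⊔ J) := by
  intro x hx n
  obtain ⟨y, hy, z, hz, rfl⟩ := Submodule.mem_sup.1 hx
  rw [map_add]
  exact Submodule.add_mem_sup (hI y hy n) (hJ z hz n)

lemma whom_frobPow (p : ℕ) [Fact p.Prime] [CharP k p] (e : ℕ) (w : σ → ℕ)
    (I : Ideal (MvPolynomial σ k)) (hI : IsWHomogeneousIdeal w I) :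
    IsWHomogeneousIdeal w (frobPow I (p ^ e)) := by
  have : frobPow I (p ^ e) = Ideal.span ((fun x => x ^ p ^ e) ''
      {x | x ∈ I ∧ ∃ d, x ∈ MvPolynomial.weightedHomogeneousSubmodule k w d}) := by
    unfold frobPow
    apply le_antisymm
    · rw [Ideal.span_le]
      rintro _ ⟨x, hx, rfl⟩
      obtain ⟨s, hs⟩ := whc_sum w x
      have h2 : x ^ p ^ e = ∑ n ∈ s, (MvPolynomial.weightedHomogeneousComponent w n x) ^ p ^ e := by
        conv_lhs => rw [hs]
        exact sum_pow_char_pow p e s _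
      simp only [SetLike.mem_coe]
      rw [h2]
      refine Ideal.sum_mem _ fun n _ => Ideal.subset_span
        ⟨_, ⟨hI x hx n, n, MvPolynomial.weightedHomogeneousComponent_mem w x n⟩, rfl⟩
    · exact Ideal.span_mono (Set.image_mono fun x hx => hx.1)
  rw [this]
  apply whom_span
  rintro _ ⟨x, ⟨-, d, hd⟩, rfl⟩
  exact ⟨_, MvPolynomial.IsWeightedHomogeneous.pow hd _⟩

lemma pow_prod_mem {ι : Type} [Fintype ι] (w : σ → ℕ) (f : ι → MvPolynomial σ k) (df : ι → ℕ)
    (hf : ∀ i, f i ∈ MvPolynomial.weightedHomogeneousSubmodule k w (df i)) (α : ι → ℕ) :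
    ∏ i, f i ^ α i ∈ MvPolynomial.weightedHomogeneousSubmodule k w (∑ i, α i * df i) := by
  have := MvPolynomial.IsWeightedHomogeneous.prod Finset.univ (fun i => f i ^ α i)
    (fun i => α i * df i) (w := w) (fun i _ => by
      have := MvPolynomial.IsWeightedHomogeneous.pow (hf i) (α i)
      simpa using this)
  exact this

lemma homog_rep {c : ℕ} (w : σ → ℕ) (f : Fin c → MvPolynomial σ k) (df : Fin c → ℕ)
    (hf : ∀ i, f i ∈ MvPolynomial.weightedHomogeneousSubmodule k w (df i))
    (Q : Ideal (MvPolynomial σ k)) (hQh : IsWHomogeneousIdeal w Q) (r N : ℕ) (s : MvPolynomial σ k)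
    (hs : s ∈ MvPolynomial.weightedHomogeneousSubmodule k w N)
    (h : s ∈ Q ⊔ (Ideal.span (Set.range f)) ^ r) :
    ∃ (S : Finset (Fin c →₀ ℕ)) (y : (Fin c →₀ ℕ) → MvPolynomial σ k),
      (∀ α ∈ S, α.degree = r) ∧ s - ∑ α ∈ S, y α * ∏ i, f i ^ α i ∈ Q ∧
      (∀ α, y α ∈ MvPolynomial.weightedHomogeneousSubmodule k w (N - ∑ i, α i * df i)) ∧
      (∀ α, ∑ i, α i * df i ≤ N ∨ y α = 0) := by
  obtain ⟨u, hu, v, hv, rfl⟩ := Submodule.mem_sup.1 h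
  obtain ⟨S, y, hS, rfl⟩ := mem_span_range_pow f r v hv
  choose y' h1 h2 h3 using fun α : Fin c →₀ ℕ => whc_mul w (∏ i, f i ^ α i) (∑ i, α i * df i)
    (pow_prod_mem w f df hf α) (y α) N
  refine ⟨S, y', hS, ?_, h1, h2⟩
  have := MvPolynomial.weightedHomogeneousComponent_eq_self hs
  rw [← this, map_add, map_sum, Finset.sum_congr rfl fun α _ => h3 α, add_sub_cancel_right]
  exact hQh u hu N

lemma lemA {c : ℕ} (w : σ → ℕ) (f : Fin c → MvPolynomial σ k) (df : Fin c → ℕ)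
    (hdf : ∀ i, 0 < df i)
    (hf : ∀ i, f i ∈ MvPolynomial.weightedHomogeneousSubmodule k w (df i))
    (q : ℕ) (hq : 0 < q)
    (Q : Ideal (MvPolynomial σ k)) (hQh : IsWHomogeneousIdeal w Q) (hQ : ∀ i, f i ^ q ∈ Q) (D : ℕ)
    (hInj : ∀ D' > D, ∀ y ∈ MvPolynomial.weightedHomogeneousSubmodule k w D',
      (∏ i, f i ^ (q - 1)) * y ∈ Q → y ∈ Q ⊔ Ideal.span (Set.range f))
    (s : MvPolynomial σ k)
    (hs : s ∈ MvPolynomial.weightedHomogeneousSubmodule k w (D + ∑ i, (q - 1) * df i))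
    (hsoc : ∀ g ∈ irrel (MvPolynomial.weightedHomogeneousSubmodule k w), g * s ∈ Q) :
    ∃ y ∈ MvPolynomial.weightedHomogeneousSubmodule k w D, s - (∏ i, f i ^ (q - 1)) * y ∈ Q := by
  have claim : ∀ r ≤ c * (q - 1), s ∈ Q ⊔ (Ideal.span (Set.range f)) ^ r := by
    intro r
    induction r with
    | zero => intro _; simp
    | succ r ih =>
      intro hr
      obtain ⟨S, y, hS, hsub, hy, hy0⟩ := homog_rep w f df hf Q hQh r _ s hs (ih (by omega))
      have : s = (s - ∑ α ∈ S, y α * ∏ i, f i ^ α i) + ∑ α ∈ S, y α * ∏ i, f i ^ α i := by ring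
      rw [this]
      refine Submodule.add_mem _ (Submodule.mem_sup_left hsub) (Submodule.sum_mem _ fun β hβ => ?_)
      by_cases hβq : ∀ i, β i < q
      · have hlt : ∃ i, β i < q - 1 := by
          by_contra! hcon
          have h1 : ∑ i : Fin c, (q - 1) ≤ ∑ i, β i := Finset.sum_le_sum fun i _ => hcon i
          have h2 := hS β hβ
          rw [Finsupp.degree_eq_sum] at h2
          simp at h1
          omega
        obtain ⟨i0, hi0⟩ := hlt
        have hw1 : ∑ i, β i * df i < ∑ i, (q - 1) * df i := by
          apply Finset.sum_lt_sum
          · intro i _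
            exact Nat.mul_le_mul_right _ (by have := hβq i; omega)
          · exact ⟨i0, Finset.mem_univ _, Nat.mul_lt_mul_of_pos_right hi0 (hdf i0)⟩
        have hirr : (∏ i, f i ^ (q - 1 - β i)) ∈ irrel (MvPolynomial.weightedHomogeneousSubmodule k w) := by
          apply Ideal.subset_span
          refine ⟨_, ?_, pow_prod_mem w f df hf (fun i => q - 1 - β i)⟩
          apply Finset.sum_pos' (fun _ _ => Nat.zero_le _)
          exact ⟨i0, Finset.mem_univ _, Nat.mul_pos (by omega) (hdf i0)⟩
        have h1 := multi_core f q hq Q hQ r S y hS β hβ hβq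
        have h2 := hsoc _ hirr
        have h3 : (∏ i, f i ^ (q - 1)) * y β ∈ Q := by
          have h4 := Q.sub_mem (Q.sub_mem h2 (Q.mul_mem_left (∏ i, f i ^ (q - 1 - β i)) hsub)) h1
          convert h4 using 1
          ring
        have h5 := hInj _ (by omega) (y β) (hy β) h3
        obtain ⟨a, ha, b, hb, hab⟩ := Submodule.mem_sup.1 h5
        rw [← hab, add_mul]
        refine Submodule.add_mem_sup (Q.mul_mem_right _ ha) ?_
        rw [pow_succ', ← hS β hβ]
        exact Ideal.mul_mem_mul hb (prod_mem_pow f β)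
      · push Not at hβq
        obtain ⟨i, hi⟩ := hβq
        exact Submodule.mem_sup_left (Q.mul_mem_left _ (prod_mem_of_le f q Q hQ β i hi))
  obtain ⟨S, y, hS, hsub, hy, hy0⟩ := homog_rep w f df hf Q hQh _ _ s hs (claim _ le_rfl)
  classical
  refine ⟨∑ α ∈ S.filter (fun α => ∀ i, α i < q), y α, ?_, ?_⟩
  · refine Submodule.sum_mem _ fun α hα => ?_
    obtain ⟨hα, hαq⟩ := Finset.mem_filter.1 hα
    have heq := hy α
    have : ∑ i, α i * df i = ∑ i, (q - 1) * df i := by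
      have h2 := hS α hα
      rw [Finsupp.degree_eq_sum] at h2
      have h3 : ∀ i ∈ Finset.univ, α i = q - 1 := by
        rw [← Finset.sum_eq_sum_iff_of_le]
        · rw [h2]; simp
        · intro i _; have := hαq i; omega
      exact Finset.sum_congr rfl fun i hi => by rw [h3 i hi]
    rw [this, Nat.add_sub_cancel] at heq
    exact heq
  · have h1 : s - (∏ i, f i ^ (q - 1)) * ∑ α ∈ S.filter (fun α => ∀ i, α i < q), y α =
      (s - ∑ α ∈ S, y α * ∏ i, f i ^ α i) +
        ∑ α ∈ S.filter (fun α => ¬ ∀ i, α i < q), y α * ∏ i, f i ^ α i := by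
      rw [← Finset.sum_filter_add_sum_filter_not S (fun α => ∀ i, α i < q) (fun α => y α * ∏ i, f i ^ α i)]
      have : ∑ α ∈ S.filter (fun α => ∀ i, α i < q), y α * ∏ i, f i ^ α i =
          (∏ i, f i ^ (q - 1)) * ∑ α ∈ S.filter (fun α => ∀ i, α i < q), y α := by
        rw [Finset.mul_sum]
        refine Finset.sum_congr rfl fun α hα => ?_
        obtain ⟨hα, hαq⟩ := Finset.mem_filter.1 hα
        have h2 := hS α hα
        rw [Finsupp.degree_eq_sum] at h2
        have h3 : ∀ i ∈ Finset.univ, α i = q - 1 := by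
          rw [← Finset.sum_eq_sum_iff_of_le]
          · rw [h2]; simp
          · intro i _; have := hαq i; omega
        rw [mul_comm]
        congr 1
        exact Finset.prod_congr rfl fun i hi => by rw [h3 i hi]
      rw [this]
      ring
    rw [h1]
    refine Q.add_mem hsub (Ideal.sum_mem _ fun α hα => ?_)
    obtain ⟨hα, hαq⟩ := Finset.mem_filter.1 hα
    push Not at hαq
    obtain ⟨i, hi⟩ := hαq
    exact Q.mul_mem_left _ (prod_mem_of_le f q Q hQ α i hi)

end Homog


section LinAlg
variable {k : Type} [Field k] {V : Type} [AddCommGroup V] [Module k V]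

lemma finrank_map_mkQ (B B0 : Submodule k V) (h : B0 ≤ B) [FiniteDimensional k B] :
    Module.finrank k (B.map B0.mkQ) + Module.finrank k B0 = Module.finrank k B := by
  have h1 := LinearMap.finrank_range_add_finrank_ker (B0.mkQ.domRestrict B)
  have h2 : LinearMap.range (B0.mkQ.domRestrict B) = B.map B0.mkQ := by
    rw [LinearMap.range_domRestrict]
  have h3 : LinearMap.ker (B0.mkQ.domRestrict B) = B0.comap B.subtype := by
    ext x; simp
  rw [h2, h3] at h1
  rw [← h1]
  congr 1
  exact (LinearEquiv.finrank_eq (Submodule.comapSubtypeEquivOfLe h)).symm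

lemma socle_lin (A A0 B B0 : Submodule k V) (hA : A0 ≤ A) (hB : B0 ≤ B) [FiniteDimensional k A]
    [FiniteDimensional k B] (T : V →ₗ[k] V) (hT0 : ∀ a ∈ A0, T a ∈ B0)
    (hT : ∀ a ∈ A, T a ∈ B)
    (hsurj : ∀ b ∈ B, ∃ a ∈ A, b - T a ∈ B0)
    (hdim : Module.finrank k A - Module.finrank k A0 ≤ Module.finrank k B - Module.finrank k B0)
    (a : V) (ha : a ∈ A) (haT : T a ∈ B0) : a ∈ A0 := by
  have h1 := LinearMap.finrank_range_add_finrank_ker ((B0.mkQ ∘ₗ T).domRestrict A)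
  have h2 : LinearMap.range ((B0.mkQ ∘ₗ T).domRestrict A) = B.map B0.mkQ := by
    rw [LinearMap.range_domRestrict]
    apply le_antisymm
    · rintro _ ⟨a, ha, rfl⟩
      exact ⟨T a, hT a ha, rfl⟩
    · rintro _ ⟨b, hb, rfl⟩
      obtain ⟨a, ha, hab⟩ := hsurj b hb
      refine ⟨a, ha, ?_⟩
      exact ((Submodule.Quotient.eq B0).2 hab).symm
  have h3 : LinearMap.ker ((B0.mkQ ∘ₗ T).domRestrict A) = (B0.comap T).comap A.subtype := by
    ext x; simp
  rw [h2, h3] at h1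
  have h4 := finrank_map_mkQ B B0 hB
  have h5 : A0.comap A.subtype ≤ (B0.comap T).comap A.subtype := fun x hx => hT0 _ hx
  have h6 : Module.finrank k (A0.comap A.subtype) = Module.finrank k A0 :=
    LinearEquiv.finrank_eq (Submodule.comapSubtypeEquivOfLe hA)
  have h8 : Module.finrank k A0 ≤ Module.finrank k A := Submodule.finrank_mono hA
  have h7 := Submodule.eq_of_le_of_finrank_le h5 (by omega)
  have h9 : (⟨a, ha⟩ : A) ∈ (B0.comap T).comap A.subtype := haT
  rw [← h7] at h9
  exact h9

lemma exists_indep_mod (B B0 : Submodule k V) (h : B0 ≤ B) [FiniteDimensional k B] :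
    ∃ u : Fin (Module.finrank k B - Module.finrank k B0) → V, (∀ i, u i ∈ B) ∧
      ∀ c : Fin (Module.finrank k B - Module.finrank k B0) → k, ∑ i, c i • u i ∈ B0 → ∀ i, c i = 0 := by
  have h4 := finrank_map_mkQ B B0 h
  have h5 : Module.finrank k (B.map B0.mkQ) = Module.finrank k B - Module.finrank k B0 := by omega
  let b := Module.finBasisOfFinrankEq k (B.map B0.mkQ) h5
  choose u hu1 hu2 using fun i => (b i).2
  refine ⟨u, hu1, fun c hc => ?_⟩
  have h6 : ∑ i, c i • b i = 0 := by
    apply Subtype.ext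
    have : B0.mkQ (∑ i, c i • u i) = 0 :=
      (Submodule.Quotient.mk_eq_zero B0).2 hc
    rw [map_sum] at this
    simp only [map_smul, hu2] at this
    simpa using this
  exact Fintype.linearIndependent_iff.1 b.linearIndependent c h6

lemma le_of_indep_mod (B B0 : Submodule k V) (h : B0 ≤ B) [FiniteDimensional k B] (L : ℕ)
    (u : Fin L → V) (hu : ∀ i, u i ∈ B)
    (hind : ∀ c : Fin L → k, ∑ i, c i • u i ∈ B0 → ∀ i, c i = 0) :
    L ≤ Module.finrank k B - Module.finrank k B0 := by
  have h4 := finrank_map_mkQ B B0 h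
  have h5 : LinearIndependent k (fun i : Fin L => (⟨B0.mkQ (u i), u i, hu i, rfl⟩ : B.map B0.mkQ)) := by
    rw [Fintype.linearIndependent_iff]
    intro c hc
    apply hind
    have := congrArg Subtype.val hc
    have h6 : B0.mkQ (∑ i, c i • u i) = 0 := by
      rw [map_sum]
      simpa using this
    exact (Submodule.Quotient.mk_eq_zero B0).1 h6
  have := h5.fintype_card_le_finrank
  simp at this
  omega

end LinAlg

section Socle
variable {k : Type} [Field k] {σ : Type} [Fintype σ]

lemma irrel_le_span (w : σ → ℕ) :
    irrel (MvPolynomial.weightedHomogeneousSubmodule k w) ≤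
      Ideal.span (Set.range (MvPolynomial.X : σ → MvPolynomial σ k)) := by
  unfold irrel
  rw [Ideal.span_le]
  rintro x ⟨n, hn, hx⟩
  rw [← Set.image_univ]
  refine (MvPolynomial.mem_ideal_span_X_image).2 fun m hm => ?_
  have h1 : Finsupp.weight w m = n := hx (MvPolynomial.mem_support_iff.1 hm)
  by_contra! hcon
  have : m = 0 := by ext i; simpa using hcon i (Set.mem_univ i)
  rw [this, map_zero] at h1
  omega

lemma X_mem_irrel (w : σ → ℕ) (hw : ∀ i, 0 < w i) (i : σ) :
    (MvPolynomial.X i : MvPolynomial σ k) ∈ irrel (MvPolynomial.weightedHomogeneousSubmodule k w) :=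
  Ideal.subset_span ⟨w i, hw i, MvPolynomial.isWeightedHomogeneous_X k w i⟩

lemma mul_irrel_mem (w : σ → ℕ) (J : Ideal (MvPolynomial σ k)) (s : MvPolynomial σ k)
    (h : ∀ i, MvPolynomial.X i * s ∈ J) (g : MvPolynomial σ k)
    (hg : g ∈ irrel (MvPolynomial.weightedHomogeneousSubmodule k w)) : g * s ∈ J := by
  have h1 := irrel_le_span w hg
  obtain ⟨y, hy⟩ := Ideal.mem_span_range_iff_exists_fun.1 h1
  rw [← hy, Finset.sum_mul]
  refine Ideal.sum_mem _ fun i _ => ?_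
  rw [mul_assoc]
  exact J.mul_mem_left _ (h i)

lemma mem_colon_irrel (w : σ → ℕ) (hw : ∀ i, 0 < w i) (J : Ideal (MvPolynomial σ k))
    (s : MvPolynomial σ k) :
    s ∈ J.colon (irrel (MvPolynomial.weightedHomogeneousSubmodule k w) : Set (MvPolynomial σ k)) ↔
      ∀ i, MvPolynomial.X i * s ∈ J := by
  rw [Submodule.mem_colon]
  constructor
  · intro h i
    have := h _ (X_mem_irrel w hw i)
    rwa [smul_eq_mul, mul_comm] at this
  · intro h g hg
    rw [smul_eq_mul, mul_comm]
    exact mul_irrel_mem w J s h g hg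

lemma fd_piece (w : σ → ℕ) (hw : ∀ i, 0 < w i) (n : ℕ) :
    FiniteDimensional k (MvPolynomial.weightedHomogeneousSubmodule k w n) :=
  Module.Finite.iff_fg.2 (MvPolynomial.weightedHomogeneousSubmodule_fg k w (fun i => (hw i).ne') n)

lemma fd_inf (w : σ → ℕ) (hw : ∀ i, 0 < w i) (n : ℕ) (S : Submodule k (MvPolynomial σ k)) :
    FiniteDimensional k (S ⊓ MvPolynomial.weightedHomogeneousSubmodule k w n : Submodule k (MvPolynomial σ k)) := by
  have := fd_piece (k := k) w hw n
  exact Submodule.finiteDimensional_of_le inf_le_right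

lemma le_colon (w : σ → ℕ) (J : Ideal (MvPolynomial σ k)) (n : ℕ) :
    (Submodule.restrictScalars k J ⊓ MvPolynomial.weightedHomogeneousSubmodule k w n) ≤
    (Submodule.restrictScalars k (J.colon
      (irrel (MvPolynomial.weightedHomogeneousSubmodule k w) : Set (MvPolynomial σ k))) ⊓
      MvPolynomial.weightedHomogeneousSubmodule k w n) := by
  refine inf_le_inf_right _ fun x hx => ?_
  exact Submodule.mem_colon.2 fun g _ => J.mul_mem_right _ hx

lemma cart_mem (p : ℕ) [Fact p.Prime] [CharP k p] (e : ℕ) (α : σ →₀ ℕ) (lam : k →+ k)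
    (hlam : ∀ a c, lam (a ^ p ^ e * c) = a * lam c) (I : Ideal (MvPolynomial σ k))
    (x : MvPolynomial σ k) (hx : x ∈ frobPow I (p ^ e)) : cart (p ^ e) α lam x ∈ I := by
  unfold frobPow at hx
  obtain ⟨a, t, hsub, ht⟩ := (Submodule.mem_span_iff_exists_finset_subset).1 hx
  rw [← ht.2, map_sum]
  refine Ideal.sum_mem _ fun g hg => ?_
  obtain ⟨y, hy, rfl⟩ := hsub hg
  simp only [smul_eq_mul]
  rw [mul_comm, cart_pow_mul p e α lam hlam]
  exact I.mul_mem_right _ hy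

lemma cart_top (q : ℕ) (hq : 0 < q) (lam : k →+ k) (c : k) :
    cart q (Finsupp.equivFunOnFinite.symm fun _ : σ => q - 1) lam
      (MvPolynomial.C c * ∏ j : σ, MvPolynomial.X j ^ (q - 1)) = MvPolynomial.C (lam c) := by
  classical
  have : (MvPolynomial.C c * ∏ j : σ, MvPolynomial.X j ^ (q - 1) : MvPolynomial σ k) =
    MvPolynomial.monomial (Finsupp.equivFunOnFinite.symm fun _ : σ => q - 1) c := by
    rw [MvPolynomial.monomial_eq, Finsupp.prod_fintype _ _ (by simp)]
    simp
  rw [this, cart_monomial, if_pos]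
  · have h0 : (Finsupp.equivFunOnFinite.symm fun _ : σ => q - 1).mapRange (· / q) (Nat.zero_div q) = 0 := by
      ext i
      simp only [Finsupp.mapRange_apply, Finsupp.equivFunOnFinite_symm_apply_apply, Finsupp.coe_zero, Pi.zero_apply]
      exact Nat.div_eq_of_lt (by omega)
    rw [h0]; rfl
  · ext i
    simp only [Finsupp.mapRange_apply, Finsupp.equivFunOnFinite_symm_apply_apply]
    exact Nat.mod_eq_of_lt (by omega)

lemma soc_lower (p : ℕ) [Fact p.Prime] [CharP k p] (e : ℕ) (w : σ → ℕ) (hw : ∀ i, 0 < w i)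
    (I : Ideal (MvPolynomial σ k)) (n : ℕ) :
    socCount (MvPolynomial.weightedHomogeneousSubmodule k w) I n ≤
    socCount (MvPolynomial.weightedHomogeneousSubmodule k w) (frobPow I (p ^ e))
      (p ^ e * n + (p ^ e - 1) * ∑ i, w i) := by
  have hq : 0 < p ^ e := pow_pos (Fact.out : p.Prime).pos _
  obtain ⟨T, b, lam, hlam, hb⟩ := exists_frob_basis (k := k) p e
  unfold socCount
  have := fd_inf (k := k) w hw
  obtain ⟨u, hu1, hu2⟩ := exists_indep_mod _ _ (le_colon w I n)
  refine le_of_indep_mod _ _ (le_colon w (frobPow I (p ^ e)) _) _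
    (fun i => (∏ j, MvPolynomial.X j ^ (p ^ e - 1)) * u i ^ p ^ e) ?_ ?_
  · intro i
    obtain ⟨h1, h2⟩ := hu1 i
    refine ⟨?_, ?_⟩
    · refine (mem_colon_irrel w hw _ _).2 fun j => ?_
      have h3 := (mem_colon_irrel w hw _ _).1 h1 j
      have h4 : (MvPolynomial.X j * u i) ^ p ^ e ∈ frobPow I (p ^ e) := Ideal.subset_span ⟨_, h3, rfl⟩
      refine Ideal.mem_of_dvd _ ?_ h4
      rw [mul_pow, ← mul_assoc]
      refine mul_dvd_mul_right ?_ _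
      have h5 : (MvPolynomial.X j : MvPolynomial σ k) ^ (p ^ e) =
        MvPolynomial.X j * MvPolynomial.X j ^ (p ^ e - 1) := by
        rw [← pow_succ', Nat.sub_add_cancel hq]
      rw [h5]
      exact mul_dvd_mul_left _ (Finset.dvd_prod_of_mem
        (fun j => (MvPolynomial.X j : MvPolynomial σ k) ^ (p ^ e - 1)) (Finset.mem_univ j))
    · have h3 := pow_prod_mem w (MvPolynomial.X : σ → MvPolynomial σ k) w
        (fun i => MvPolynomial.isWeightedHomogeneous_X k w i) (fun _ => p ^ e - 1)
      rw [← Finset.mul_sum] at h3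
      have h4 := MvPolynomial.IsWeightedHomogeneous.mul h3
        (MvPolynomial.IsWeightedHomogeneous.pow h2 (p ^ e))
      rw [smul_eq_mul, add_comm] at h4
      exact h4
  · intro c hc
    have h1 : ∀ j i, lam j (c i) = 0 := by
      intro j
      apply hu2
      refine ⟨?_, Submodule.sum_mem _ fun i _ => Submodule.smul_mem _ _ (hu1 i).2⟩
      have h2 := cart_mem p e (Finsupp.equivFunOnFinite.symm fun _ : σ => p ^ e - 1) (lam j)
        (hlam j) I _ hc.1
      rw [map_sum] at h2
      have h3 : ∀ i, cart (p ^ e) (Finsupp.equivFunOnFinite.symm fun _ : σ => p ^ e - 1) (lam j)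
          (c i • ((∏ j, MvPolynomial.X j ^ (p ^ e - 1)) * u i ^ p ^ e)) = lam j (c i) • u i := by
        intro i
        have : c i • ((∏ j, MvPolynomial.X j ^ (p ^ e - 1)) * u i ^ p ^ e) =
          u i ^ p ^ e * (MvPolynomial.C (c i) * ∏ j, MvPolynomial.X j ^ (p ^ e - 1)) := by
          rw [MvPolynomial.smul_eq_C_mul]; ring
        rw [this, cart_pow_mul p e _ _ (hlam j), cart_top _ hq, MvPolynomial.smul_eq_C_mul, mul_comm]
      simp only [h3] at h2
      exact h2
    intro i
    obtain ⟨s, hs⟩ := hb (c i)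
    rw [hs s subset_rfl]
    refine Finset.sum_eq_zero fun j _ => ?_
    rw [h1 j i, zero_pow hq.ne', zero_mul]

lemma high_mem (w : σ → ℕ) (hw : ∀ i, 0 < w i) (Q : Ideal (MvPolynomial σ k))
    (h : ∀ i, (MvPolynomial.X i : MvPolynomial σ k) ∈ Q.radical) :
    ∃ N, ∀ D, N ≤ D → ∀ y ∈ MvPolynomial.weightedHomogeneousSubmodule k w D, y ∈ Q := by
  choose M hM using h
  refine ⟨∑ i, M i * w i + 1, fun D hD y hy => ?_⟩
  rw [y.as_sum]
  refine Ideal.sum_mem _ fun m hm => ?_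
  have h1 : Finsupp.weight w m = D := hy (MvPolynomial.mem_support_iff.1 hm)
  have h2 : ∃ i, M i ≤ m i := by
    by_contra! hcon
    have h3 : Finsupp.weight w m ≤ ∑ i, M i * w i := by
      rw [Finsupp.weight_apply, Finsupp.sum_fintype _ _ (by simp)]
      exact Finset.sum_le_sum fun i _ => Nat.mul_le_mul_right _ (hcon i).le
    omega
  obtain ⟨i, hi⟩ := h2
  refine Ideal.mem_of_dvd _ ?_ (hM i)
  rw [MvPolynomial.X_pow_eq_monomial, MvPolynomial.monomial_dvd_monomial]
  refine ⟨Or.inr ?_, one_dvd _⟩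
  simpa using hi

lemma inj_main (p : ℕ) [Fact p.Prime] [CharP k p] (e : ℕ) (w : σ → ℕ) (hw : ∀ i, 0 < w i)
    {c : ℕ} (f : Fin c → MvPolynomial σ k) (df : Fin c → ℕ) (hdf : ∀ i, 0 < df i)
    (hf : ∀ i, f i ∈ MvPolynomial.weightedHomogeneousSubmodule k w (df i))
    (I : Ideal (MvPolynomial σ k)) (hI : IsWHomogeneousIdeal w I) (hfI : ∀ i, f i ∈ I)
    (hIprim : I.radical = irrel (MvPolynomial.weightedHomogeneousSubmodule k w))
    (hdim : ∀ D : ℕ, socCount (MvPolynomial.weightedHomogeneousSubmodule k w)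
      (frobPow I (p ^ e) ⊔ Ideal.span (Set.range f)) D ≤
      socCount (MvPolynomial.weightedHomogeneousSubmodule k w)
        (frobPow I (p ^ e)) (D + ∑ i, (p ^ e - 1) * df i))
    (y : MvPolynomial σ k) (hy : (∏ i, f i ^ (p ^ e - 1)) * y ∈ frobPow I (p ^ e)) :
    y ∈ frobPow I (p ^ e) ⊔ Ideal.span (Set.range f) := by
  have hq : 0 < p ^ e := pow_pos (Fact.out : p.Prime).pos _
  have hQh := whom_frobPow p e w I hI
  have hQ : ∀ i, f i ^ p ^ e ∈ frobPow I (p ^ e) := fun i => Ideal.subset_span ⟨_, hfI i, rfl⟩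
  have hdimfd := fd_inf (k := k) w hw
  have hFmem := pow_prod_mem w f df hf (fun _ => p ^ e - 1)
  obtain ⟨N, hN⟩ := high_mem w hw (frobPow I (p ^ e)) (by
    intro i
    have h1 : (MvPolynomial.X i : MvPolynomial σ k) ∈ I.radical := by
      rw [hIprim]; exact X_mem_irrel w hw i
    obtain ⟨m, hm⟩ := h1
    exact ⟨m * p ^ e, by rw [pow_mul]; exact Ideal.subset_span ⟨_, hm, rfl⟩⟩)
  have main : ∀ t D : ℕ, N ≤ D + t → ∀ y ∈ MvPolynomial.weightedHomogeneousSubmodule k w D,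
      (∏ i, f i ^ (p ^ e - 1)) * y ∈ frobPow I (p ^ e) →
      y ∈ frobPow I (p ^ e) ⊔ Ideal.span (Set.range f) := by
    intro t
    induction t with
    | zero => intro D hD y hy _; exact Submodule.mem_sup_left (hN D hD y hy)
    | succ t ih =>
      intro D hD
      have hInj : ∀ D' > D, ∀ y ∈ MvPolynomial.weightedHomogeneousSubmodule k w D',
        (∏ i, f i ^ (p ^ e - 1)) * y ∈ frobPow I (p ^ e) →
        y ∈ frobPow I (p ^ e) ⊔ Ideal.span (Set.range f) := fun D' hD' => ih D' (by omega)
      have hstep : ∀ y ∈ MvPolynomial.weightedHomogeneousSubmodule k w D,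
          ∀ i, MvPolynomial.X i * ((∏ i, f i ^ (p ^ e - 1)) * y) ∈ frobPow I (p ^ e) →
          MvPolynomial.X i * y ∈ frobPow I (p ^ e) ⊔ Ideal.span (Set.range f) := by
        intro y hy i h
        apply hInj (w i + D) (by have := hw i; omega) _
          (MvPolynomial.IsWeightedHomogeneous.mul (MvPolynomial.isWeightedHomogeneous_X k w i) hy)
        convert h using 1
        ring
      have hFJ : ∀ a ∈ frobPow I (p ^ e) ⊔ Ideal.span (Set.range f),
          (∏ i, f i ^ (p ^ e - 1)) * a ∈ frobPow I (p ^ e) := by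
        intro a ha
        obtain ⟨b, hb, z, hz, rfl⟩ := Submodule.mem_sup.1 ha
        rw [mul_add]
        refine Ideal.add_mem _ (Ideal.mul_mem_left _ _ hb) ?_
        obtain ⟨g, hg⟩ := Ideal.mem_span_range_iff_exists_fun.1 hz
        rw [← hg, Finset.mul_sum]
        refine Ideal.sum_mem _ fun i _ => ?_
        refine Ideal.mem_of_dvd _ ?_ (hQ i)
        have h5 : f i ^ (p ^ e) = f i ^ (p ^ e - 1) * f i := by
          rw [← pow_succ, Nat.sub_add_cancel hq]
        rw [h5]
        exact mul_dvd_mul (Finset.dvd_prod_of_mem (fun j => f j ^ (p ^ e - 1)) (Finset.mem_univ i))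
          (Dvd.intro_left _ rfl)
      intro y hy hFy
      have := socle_lin _ _ _ _ (le_colon w (frobPow I (p ^ e) ⊔ Ideal.span (Set.range f)) D)
        (le_colon w (frobPow I (p ^ e)) (D + ∑ i, (p ^ e - 1) * df i))
        (LinearMap.mulLeft k (∏ i, f i ^ (p ^ e - 1))) ?_ ?_ ?_ (hdim D) y ?_ ?_
      · exact this.1
      · rintro a ⟨h1, h2⟩
        refine ⟨hFJ a h1, ?_⟩
        have := MvPolynomial.IsWeightedHomogeneous.mul hFmem h2
        rwa [add_comm] at this
      · rintro a ⟨h1, h2⟩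
        refine ⟨?_, ?_⟩
        · refine (mem_colon_irrel w hw _ _).2 fun j => ?_
          have h3 := hFJ _ ((mem_colon_irrel w hw _ _).1 h1 j)
          convert h3 using 1
          simp only [LinearMap.mulLeft_apply]
          ring
        · have := MvPolynomial.IsWeightedHomogeneous.mul hFmem h2
          rwa [add_comm] at this
      · rintro s ⟨h1, h2⟩
        have h3 := (mem_colon_irrel w hw _ _).1 h1
        obtain ⟨z, hz, hsz⟩ := lemA w f df hdf hf (p ^ e) hq (frobPow I (p ^ e)) hQh hQ D hInj s h2
          (mul_irrel_mem w _ s h3)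
        refine ⟨z, ⟨?_, hz⟩, ⟨hsz, ?_⟩⟩
        · refine (mem_colon_irrel w hw _ _).2 fun j => ?_
          apply hstep z hz
          have h4 := Ideal.sub_mem _ (h3 j) (Ideal.mul_mem_left _ (MvPolynomial.X j) hsz)
          convert h4 using 1
          ring
        · refine Submodule.sub_mem _ h2 ?_
          have := MvPolynomial.IsWeightedHomogeneous.mul hFmem hz
          rwa [add_comm] at this
      · refine ⟨(mem_colon_irrel w hw _ _).2 fun j => ?_, hy⟩
        exact hstep y hy j (Ideal.mul_mem_left _ _ hFy)
      · refine ⟨hFy, ?_⟩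
        have := MvPolynomial.IsWeightedHomogeneous.mul hFmem hy
        rwa [add_comm] at this
  obtain ⟨s, hs⟩ := whc_sum w y
  rw [hs]
  refine Submodule.sum_mem _ fun n _ => ?_
  refine main N n (by omega) _ (MvPolynomial.weightedHomogeneousComponent_mem w y n) ?_
  have h1 := hQh _ hy (n + ∑ i, (p ^ e - 1) * df i)
  have h2 : MvPolynomial.weightedHomogeneousComponent w (n + ∑ i, (p ^ e - 1) * df i)
      ((∏ i, f i ^ (p ^ e - 1)) * y) =
      (∏ i, f i ^ (p ^ e - 1)) * MvPolynomial.weightedHomogeneousComponent w n y := by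
    conv_lhs => rw [hs]
    have h3 : ∀ m, MvPolynomial.weightedHomogeneousComponent w (n + ∑ i, (p ^ e - 1) * df i)
      ((∏ i, f i ^ (p ^ e - 1)) * MvPolynomial.weightedHomogeneousComponent w m y) =
      (∏ i, f i ^ (p ^ e - 1)) * MvPolynomial.weightedHomogeneousComponent w n
        (MvPolynomial.weightedHomogeneousComponent w m y) := by
      intro m
      have h4 := MvPolynomial.IsWeightedHomogeneous.mul hFmem
        (MvPolynomial.weightedHomogeneousComponent_mem w y m)
      rw [MvPolynomial.weightedHomogeneousComponent_of_mem h4,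
        MvPolynomial.weightedHomogeneousComponent_of_mem
          (MvPolynomial.weightedHomogeneousComponent_mem w y m)]
      by_cases h : n = m
      · rw [if_pos h, if_pos (by omega)]
      · rw [if_neg h, if_neg (by omega), mul_zero]
    rw [Finset.mul_sum, map_sum, Finset.sum_congr rfl fun m _ => h3 m, ← Finset.mul_sum, ← map_sum, ← hs]
  rw [h2] at h1
  exact h1

end Socle


section Hilb
variable {k : Type} [Field k] {σ : Type} [Fintype σ]

lemma hilb_step (w : σ → ℕ) (hw : ∀ i, 0 < w i) (J : Ideal (MvPolynomial σ k))
    (hJ : IsWHomogeneousIdeal w J) (g : MvPolynomial σ k) (d : ℕ)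
    (hg : g ∈ MvPolynomial.weightedHomogeneousSubmodule k w d)
    (hreg : ∀ y, g * y ∈ J → y ∈ J) :
    hilbQ (MvPolynomial.weightedHomogeneousSubmodule k w) (J ⊔ Ideal.span {g}) =
      (1 - PowerSeries.X ^ d) * hilbQ (MvPolynomial.weightedHomogeneousSubmodule k w) J := by
  have hfd := fd_inf (k := k) w hw
  have hfd0 := fd_piece (k := k) w hw
  have rep : ∀ n, ∀ x ∈ MvPolynomial.weightedHomogeneousSubmodule k w n, x ∈ J ⊔ Ideal.span {g} →
      ∃ y ∈ MvPolynomial.weightedHomogeneousSubmodule k w (n - d), (d ≤ n ∨ y = 0) ∧ x - g * y ∈ J := by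
    intro n x hx hxJ
    obtain ⟨u, hu, v, hv, rfl⟩ := Submodule.mem_sup.1 hxJ
    obtain ⟨y, rfl⟩ := Ideal.mem_span_singleton'.1 hv
    obtain ⟨y', h1, h2, h3⟩ := whc_mul w g d hg y n
    refine ⟨y', h1, h2, ?_⟩
    rw [← MvPolynomial.weightedHomogeneousComponent_eq_self hx, map_add, h3, mul_comm g,
      add_sub_cancel_right]
    exact hJ u hu n
  have hle : ∀ n, (Submodule.restrictScalars k J ⊓ MvPolynomial.weightedHomogeneousSubmodule k w n) ≤
      (Submodule.restrictScalars k (J ⊔ Ideal.span {g}) ⊓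
        MvPolynomial.weightedHomogeneousSubmodule k w n) := fun n =>
    inf_le_inf_right _ fun x hx => Submodule.mem_sup_left (S := J) hx
  ext n
  rw [sub_mul, one_mul, map_sub, PowerSeries.coeff_X_pow_mul']
  unfold hilbQ
  simp only [PowerSeries.coeff_mk]
  by_cases hdn : d ≤ n
  · rw [if_pos hdn]
    have h4 := finrank_map_mkQ _ _ (hle n)
    set J0 := (Submodule.restrictScalars k J ⊓ MvPolynomial.weightedHomogeneousSubmodule k w n) with hJ0
    have h1 := LinearMap.finrank_range_add_finrank_ker ((J0.mkQ ∘ₗ LinearMap.mulLeft k g).domRestrict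
      (MvPolynomial.weightedHomogeneousSubmodule k w (n - d)))
    have hgm : ∀ y ∈ MvPolynomial.weightedHomogeneousSubmodule k w (n - d),
        g * y ∈ MvPolynomial.weightedHomogeneousSubmodule k w n := by
      intro y hy
      have := MvPolynomial.IsWeightedHomogeneous.mul hg hy
      rwa [Nat.add_sub_cancel' hdn] at this
    have h2 : LinearMap.range ((J0.mkQ ∘ₗ LinearMap.mulLeft k g).domRestrict
      (MvPolynomial.weightedHomogeneousSubmodule k w (n - d))) =
      (Submodule.restrictScalars k (J ⊔ Ideal.span {g}) ⊓
        MvPolynomial.weightedHomogeneousSubmodule k w n).map J0.mkQ := by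
      rw [LinearMap.range_domRestrict]
      apply le_antisymm
      · rintro _ ⟨y, hy, rfl⟩
        refine ⟨g * y, ⟨?_, hgm y hy⟩, rfl⟩
        exact Submodule.mem_sup_right (Ideal.mul_mem_right _ _ (Ideal.mem_span_singleton_self g))
      · rintro _ ⟨x, ⟨hx1, hx2⟩, rfl⟩
        obtain ⟨y, hy, -, hy2⟩ := rep n x hx2 hx1
        refine ⟨y, hy, ?_⟩
        exact ((Submodule.Quotient.eq J0).2 ⟨hy2, Submodule.sub_mem _ hx2 (hgm y hy)⟩).symm
    have h3 : LinearMap.ker ((J0.mkQ ∘ₗ LinearMap.mulLeft k g).domRestrict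
      (MvPolynomial.weightedHomogeneousSubmodule k w (n - d))) =
      (Submodule.restrictScalars k J ⊓ MvPolynomial.weightedHomogeneousSubmodule k w (n - d)).comap
        (MvPolynomial.weightedHomogeneousSubmodule k w (n - d)).subtype := by
      ext x
      rw [LinearMap.mem_ker]
      refine (Submodule.Quotient.mk_eq_zero J0).trans ?_
      constructor
      · intro h
        exact ⟨hreg _ h.1, x.2⟩
      · intro h
        exact ⟨J.mul_mem_left _ h.1, hgm _ x.2⟩
    rw [h2, h3, LinearEquiv.finrank_eq (Submodule.comapSubtypeEquivOfLe inf_le_right)] at h1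
    rw [← h4, ← h1]
    push_cast
    ring
  · rw [if_neg hdn, sub_zero]
    have : (Submodule.restrictScalars k (J ⊔ Ideal.span {g}) ⊓
        MvPolynomial.weightedHomogeneousSubmodule k w n) =
        (Submodule.restrictScalars k J ⊓ MvPolynomial.weightedHomogeneousSubmodule k w n) := by
      refine le_antisymm ?_ (hle n)
      rintro x ⟨hx1, hx2⟩
      obtain ⟨y, hy, h1, h2⟩ := rep n x hx2 hx1
      rcases h1 with h1 | h1
      · exact absurd h1 hdn
      · rw [h1, mul_zero, sub_zero] at h2
        exact ⟨h2, hx2⟩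
    rw [this]

lemma hilb_vars (w : σ → ℕ) (hw : ∀ i, 0 < w i) :
    (1 : PowerSeries ℤ) = (∏ i, (1 - PowerSeries.X ^ w i)) *
      hilbQ (MvPolynomial.weightedHomogeneousSubmodule k w) ⊥ := by
  classical
  have h1 : ∀ s : Finset σ, hilbQ (MvPolynomial.weightedHomogeneousSubmodule k w)
      (Ideal.span ((MvPolynomial.X : σ → MvPolynomial σ k) '' s)) = (∏ i ∈ s, (1 - PowerSeries.X ^ w i)) *
      hilbQ (MvPolynomial.weightedHomogeneousSubmodule k w) ⊥ := by
    intro s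
    induction s using Finset.induction_on with
    | empty => simp
    | insert i s hi ih =>
      rw [Finset.prod_insert hi, mul_assoc, ← ih, ← hilb_step w hw _ _ (MvPolynomial.X i) (w i)
        (MvPolynomial.isWeightedHomogeneous_X k w i)]
      · rw [Finset.coe_insert, Set.image_insert_eq, Ideal.span_insert, sup_comm]
      · intro y hy
        rw [MvPolynomial.mem_ideal_span_X_image] at hy ⊢
        intro m hm
        have h2 : m + Finsupp.single i 1 ∈ (MvPolynomial.X i * y).support := by
          rw [MvPolynomial.mem_support_iff, add_comm, MvPolynomial.coeff_X_mul]
          exact MvPolynomial.mem_support_iff.1 hm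
        obtain ⟨j, hj, hj2⟩ := hy _ h2
        refine ⟨j, hj, ?_⟩
        have : j ≠ i := by rintro rfl; exact hi hj
        simpa [Finsupp.single_apply, this.symm] using hj2
      · apply whom_span
        rintro _ ⟨j, -, rfl⟩
        exact ⟨_, MvPolynomial.isWeightedHomogeneous_X k w j⟩
  rw [← h1 Finset.univ]
  ext n
  unfold hilbQ
  rw [PowerSeries.coeff_mk, PowerSeries.coeff_one]
  rw [Finset.coe_univ]
  by_cases hn : n = 0
  · subst hn
    rw [if_pos rfl]
    have h2 : (MvPolynomial.weightedHomogeneousSubmodule k w 0) =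
        Submodule.span k {(1 : MvPolynomial σ k)} := by
      apply le_antisymm
      · intro x hx
        rw [Submodule.mem_span_singleton]
        refine ⟨MvPolynomial.coeff 0 x, ?_⟩
        rw [MvPolynomial.smul_eq_C_mul, mul_one]
        ext m
        rw [MvPolynomial.coeff_C]
        split_ifs with h
        · rw [h]
        · by_contra hcon
          have h3 : Finsupp.weight w m = 0 := hx (Ne.symm hcon)
          apply h
          ext i
          rw [Finsupp.weight_apply, Finsupp.sum_fintype _ _ (by simp), Finset.sum_eq_zero_iff] at h3
          have := h3 i (Finset.mem_univ i)
          have h4 := hw i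
          simp at this
          simp
          omega
      · rw [Submodule.span_le]
        rintro _ rfl
        exact MvPolynomial.isWeightedHomogeneous_one k w
    have h3 : (Submodule.restrictScalars k (Ideal.span ((MvPolynomial.X : σ → MvPolynomial σ k) '' Set.univ)) ⊓
        MvPolynomial.weightedHomogeneousSubmodule k w 0) = ⊥ := by
      rw [eq_bot_iff]
      rintro x ⟨hx1, hx2⟩
      rw [h2] at hx2
      obtain ⟨c, rfl⟩ := Submodule.mem_span_singleton.1 hx2
      have hx3 := MvPolynomial.mem_ideal_span_X_image.1 hx1
      by_cases hc : c = 0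
      · simp [hc]
      · obtain ⟨i, -, hi⟩ := hx3 0 (by
          rw [MvPolynomial.mem_support_iff]
          simpa using hc)
        simp at hi
    rw [h3, h2, finrank_span_singleton one_ne_zero]
    simp
  · rw [if_neg hn]
    have h3 : (Submodule.restrictScalars k (Ideal.span ((MvPolynomial.X : σ → MvPolynomial σ k) '' Set.univ)) ⊓
        MvPolynomial.weightedHomogeneousSubmodule k w n) =
        MvPolynomial.weightedHomogeneousSubmodule k w n := by
      rw [inf_eq_right]
      intro x hx
      rw [Set.image_univ]
      exact irrel_le_span w (Ideal.subset_span ⟨n, Nat.pos_of_ne_zero hn, hx⟩)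
    rw [h3, sub_self]

lemma reg_take {c : ℕ} (f : Fin c → MvPolynomial σ k)
    (hreg : RingTheory.Sequence.IsRegular (MvPolynomial σ k) (List.ofFn f)) (j : Fin c)
    (y : MvPolynomial σ k) (hy : f j * y ∈ Ideal.ofList ((List.ofFn f).take j)) :
    y ∈ Ideal.ofList ((List.ofFn f).take j) := by
  have h := hreg.regular_mod_prev j (by simp)
  rw [smul_eq_mul, Ideal.mul_top] at h
  have h2 : (List.ofFn f)[(j : ℕ)]'(by simp) = f j := by simp
  rw [h2] at h
  rw [isSMulRegular_quotient_iff_mem_of_smul_mem] at h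
  exact h y hy

lemma take_succ_ideal {c : ℕ} (f : Fin c → MvPolynomial σ k) (j : Fin c) :
    Ideal.ofList ((List.ofFn f).take (j + 1)) =
      Ideal.ofList ((List.ofFn f).take j) ⊔ Ideal.span {f j} := by
  rw [List.take_add_one, Ideal.ofList_append]
  congr 1
  simp

lemma hilb_ci (w : σ → ℕ) (hw : ∀ i, 0 < w i) {c : ℕ} (f : Fin c → MvPolynomial σ k)
    (df : Fin c → ℕ)
    (hreg : RingTheory.Sequence.IsRegular (MvPolynomial σ k) (List.ofFn f))
    (hf : ∀ i, f i ∈ MvPolynomial.weightedHomogeneousSubmodule k w (df i)) :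
    hilbQ (MvPolynomial.weightedHomogeneousSubmodule k w) (Ideal.span (Set.range f)) =
      (∏ i, (1 - PowerSeries.X ^ df i)) *
      hilbQ (MvPolynomial.weightedHomogeneousSubmodule k w) ⊥ := by
  have h1 : ∀ j ≤ c, hilbQ (MvPolynomial.weightedHomogeneousSubmodule k w)
      (Ideal.ofList ((List.ofFn f).take j)) =
      (∏ i ∈ Finset.univ.filter (fun i : Fin c => (i : ℕ) < j), (1 - PowerSeries.X ^ df i)) *
      hilbQ (MvPolynomial.weightedHomogeneousSubmodule k w) ⊥ := by
    intro j
    induction j with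
    | zero => intro _; simp
    | succ j ih =>
      intro hj
      rw [take_succ_ideal f ⟨j, hj⟩, hilb_step w hw _ _ (f ⟨j, hj⟩) (df ⟨j, hj⟩) (hf _)
        (reg_take f hreg ⟨j, hj⟩), ih (by omega), ← mul_assoc]
      · congr 1
        have : Finset.univ.filter (fun i : Fin c => (i : ℕ) < j + 1) =
          insert ⟨j, hj⟩ (Finset.univ.filter (fun i : Fin c => (i : ℕ) < j)) := by
          ext i
          simp [Fin.ext_iff]
          omega
        rw [this, Finset.prod_insert (by simp)]
      · apply whom_span
        intro g hg
        have hg2 := List.mem_of_mem_take hg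
        obtain ⟨i, rfl⟩ := (List.mem_ofFn).1 hg2
        exact ⟨_, hf i⟩
  have h2 := h1 c le_rfl
  have h3 : Ideal.ofList ((List.ofFn f).take c) = Ideal.span (Set.range f) := by
    rw [List.take_of_length_le (by simp)]
    unfold Ideal.ofList
    congr 1
    ext x
    simp [List.mem_ofFn]
  rw [h3] at h2
  rw [h2]
  congr 1
  apply Finset.prod_congr _ fun _ _ => rfl
  ext i
  simp

lemma df_pos (w : σ → ℕ) (hw : ∀ i, 0 < w i) {c : ℕ} (f : Fin c → MvPolynomial σ k)
    (df : Fin c → ℕ)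
    (hreg : RingTheory.Sequence.IsRegular (MvPolynomial σ k) (List.ofFn f))
    (hf : ∀ i, f i ∈ MvPolynomial.weightedHomogeneousSubmodule k w (df i))
    (hne : Ideal.span (Set.range f) ≠ ⊤) (i : Fin c) : 0 < df i := by
  classical
  by_contra hcon
  have h0 : df i = 0 := by omega
  have h1 := hf i
  rw [h0] at h1
  have h2 : f i = MvPolynomial.C (MvPolynomial.coeff 0 (f i)) := by
    ext m
    rw [MvPolynomial.coeff_C]
    split_ifs with h
    · rw [h]
    · by_contra hcon
      have h3 : Finsupp.weight w m = 0 := h1 hcon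
      apply h
      ext i
      rw [Finsupp.weight_apply, Finsupp.sum_fintype _ _ (by simp), Finset.sum_eq_zero_iff] at h3
      have := h3 i (Finset.mem_univ i)
      have h4 := hw i
      simp at this
      simp
      omega
  by_cases hz : MvPolynomial.coeff 0 (f i) = 0
  · rw [hz, map_zero] at h2
    have h3 := reg_take f hreg i 1 (by rw [h2, zero_mul]; exact Ideal.zero_mem _)
    apply hne
    rw [Ideal.eq_top_iff_one]
    refine Ideal.span_mono ?_ h3
    intro x hx
    obtain ⟨j, rfl⟩ := (List.mem_ofFn).1 (List.mem_of_mem_take hx)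
    exact ⟨j, rfl⟩
  · apply hne
    refine Ideal.eq_top_of_isUnit_mem _ (Ideal.subset_span ⟨i, rfl⟩) ?_
    rw [h2]
    exact (isUnit_iff_ne_zero.2 hz).map MvPolynomial.C

lemma natDegree_one_sub (d : ℕ) (hd : 0 < d) : (1 - Polynomial.X ^ d : Polynomial ℤ).natDegree = d := by
  rw [← neg_sub, Polynomial.natDegree_neg]
  exact Polynomial.natDegree_X_pow_sub_C (r := (1 : ℤ))

lemma natDegree_prod_one_sub {ι : Type} [Fintype ι] (d : ι → ℕ) (hd : ∀ i, 0 < d i) :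
    (∏ i, (1 - Polynomial.X ^ d i : Polynomial ℤ)) ≠ 0 ∧
    (∏ i, (1 - Polynomial.X ^ d i : Polynomial ℤ)).natDegree = ∑ i, d i := by
  have h : ∀ i, (1 - Polynomial.X ^ d i : Polynomial ℤ) ≠ 0 := by
    intro i h0
    have := natDegree_one_sub (d i) (hd i)
    rw [h0, Polynomial.natDegree_zero] at this
    have := hd i
    omega
  refine ⟨Finset.prod_ne_zero_iff.2 fun i _ => h i, ?_⟩
  rw [Polynomial.natDegree_prod _ _ fun i _ => h i]
  exact Finset.sum_congr rfl fun i _ => natDegree_one_sub (d i) (hd i)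

lemma coe_prod_one_sub {ι : Type} [Fintype ι] (d : ι → ℕ) :
    ((∏ i, (1 - Polynomial.X ^ d i) : Polynomial ℤ) : PowerSeries ℤ) =
      ∏ i, (1 - PowerSeries.X ^ d i) := by
  refine (map_prod (Polynomial.coeToPowerSeries.ringHom (R := ℤ))
    (fun i => 1 - Polynomial.X ^ d i) Finset.univ).trans ?_
  refine Finset.prod_congr rfl fun i _ => ?_
  rw [map_sub, map_one, map_pow]
  congr 2
  exact Polynomial.coe_X

lemma a_eq (w : σ → ℕ) (hw : ∀ i, 0 < w i) {c : ℕ} (f : Fin c → MvPolynomial σ k)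
    (df : Fin c → ℕ)
    (hreg : RingTheory.Sequence.IsRegular (MvPolynomial σ k) (List.ofFn f))
    (hf : ∀ i, f i ∈ MvPolynomial.weightedHomogeneousSubmodule k w (df i))
    (hdf : ∀ i, 0 < df i) (a : ℤ)
    (ha : IsAInv (MvPolynomial.weightedHomogeneousSubmodule k w) (Ideal.span (Set.range f)) a) :
    a = ((∑ i, df i : ℕ) : ℤ) - ((∑ i, w i : ℕ) : ℤ) := by
  obtain ⟨num, den, hden, h1, rfl⟩ := ha
  obtain ⟨hw0, hw1⟩ := natDegree_prod_one_sub w hw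
  obtain ⟨hd0, hd1⟩ := natDegree_prod_one_sub df hdf
  have h2 : num * (∏ i, (1 - Polynomial.X ^ w i)) = den * (∏ i, (1 - Polynomial.X ^ df i)) := by
    apply Polynomial.coe_injective ℤ
    rw [Polynomial.coe_mul, Polynomial.coe_mul, coe_prod_one_sub, coe_prod_one_sub, ← h1,
      hilb_ci w hw f df hreg hf]
    have := hilb_vars (k := k) w hw
    calc _ = (den : PowerSeries ℤ) * (∏ i, (1 - PowerSeries.X ^ df i)) * ((∏ i, (1 - PowerSeries.X ^ w i)) *
      hilbQ (MvPolynomial.weightedHomogeneousSubmodule k w) ⊥) := by ring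
      _ = _ := by rw [← this, mul_one]
  have hnum : num ≠ 0 := by
    rintro rfl
    rw [zero_mul] at h2
    exact mul_ne_zero hden hd0 h2.symm
  have h3 := congrArg Polynomial.natDegree h2
  rw [Polynomial.natDegree_mul hnum hw0, Polynomial.natDegree_mul hden hd0, hw1, hd1] at h3
  omega

end Hilb

/-- **Theorem 1.8.** Let `R = P/C` be a graded complete intersection over a field of
characteristic `p`, `S = R/J` an artinian graded quotient with socle degrees
`d 0 ≤ … ≤ d (ℓ-1)`, and `q = p^e`.  If the socle of `F_R^e(S) = R/J^{[q]}` also has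
dimension `ℓ`, with socle degrees `D i = q·d i - (q-1)·a(R)`, then
`Tor_1^R(S, ^{φ_R^e}R) = 0`. -/
theorem socle_degrees_stmt1
    {k : Type} [Field k] (p : ℕ) [Fact p.Prime] [CharP k p]
    {σ : Type} [Fintype σ] (w : σ → ℕ) (hw : ∀ i, 0 < w i)
    (e : ℕ) (he : 0 < e) (q : ℕ) (hq : q = p ^ e)
    (c : ℕ) (f : Fin c → MvPolynomial σ k) (df : Fin c → ℕ)
    (hreg : RingTheory.Sequence.IsRegular (MvPolynomial σ k) (List.ofFn f))
    (hf : ∀ i, f i ∈ MvPolynomial.weightedHomogeneousSubmodule k w (df i))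
    (C : Ideal (MvPolynomial σ k)) (hC : C = Ideal.span (Set.range f))
    [CharP (MvPolynomial σ k ⧸ C) p]
    (I : Ideal (MvPolynomial σ k)) (hI : IsWHomogeneousIdeal w I) (hCI : C ≤ I)
    (hIprim : I.radical = irrel (MvPolynomial.weightedHomogeneousSubmodule k w))
    (a : ℤ) (ha : IsAInv (MvPolynomial.weightedHomogeneousSubmodule k w) C a)
    {ℓ : ℕ} (d : Fin ℓ → ℕ)
    (hd : HasSocleDegrees (MvPolynomial.weightedHomogeneousSubmodule k w) I d)
    (hDpos : ∀ i, (0 : ℤ) ≤ (q : ℤ) * d i - ((q : ℤ) - 1) * a)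
    (hD : ∀ n : ℕ,
      socCount (MvPolynomial.weightedHomogeneousSubmodule k w) (frobPow I q + C) n =
        (univ.filter fun i => (q : ℤ) * d i - ((q : ℤ) - 1) * a = (n : ℤ)).card) :
    Subsingleton (TorM (MvPolynomial σ k ⧸ C) 1
      (ModuleCat.of (MvPolynomial σ k ⧸ C)
        ((MvPolynomial σ k ⧸ C) ⧸ I.map (Ideal.Quotient.mk C)))
      (frobMod (MvPolynomial σ k ⧸ C) p e)) := by
  subst hC
  have hp : p.Prime := Fact.out
  have hq0 : 0 < q := by rw [hq]; exact pow_pos hp.pos _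
  have hne : Ideal.span (Set.range f) ≠ ⊤ := by
    intro h
    have : Nontrivial (MvPolynomial σ k ⧸ Ideal.span (Set.range f)) :=
      CharP.nontrivial_of_char_ne_one (v := p) hp.ne_one
    exact (Ideal.Quotient.nontrivial_iff.1 this) h
  have hdf := df_pos w hw f df hreg hf hne
  have haeq := a_eq w hw f df hreg hf hdf a ha
  have hfI : ∀ i, f i ∈ I := fun i => hCI (Ideal.subset_span ⟨i, rfl⟩)
  have hdim : ∀ D : ℕ, socCount (MvPolynomial.weightedHomogeneousSubmodule k w)
      (frobPow I (p ^ e) ⊔ Ideal.span (Set.range f)) D ≤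
      socCount (MvPolynomial.weightedHomogeneousSubmodule k w)
        (frobPow I (p ^ e)) (D + ∑ i, (p ^ e - 1) * df i) := by
    intro D
    have h1 := hD D
    rw [Submodule.add_eq_sup, hq] at h1
    rw [h1]
    by_cases hex : ∃ i0, ((p ^ e : ℕ) : ℤ) * d i0 - (((p ^ e : ℕ) : ℤ) - 1) * a = (D : ℤ)
    · obtain ⟨i0, hi0⟩ := hex
      have h2 : (univ.filter fun i => ((p ^ e : ℕ) : ℤ) * d i - (((p ^ e : ℕ) : ℤ) - 1) * a = (D : ℤ)) =
          univ.filter fun i => d i = d i0 := by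
        ext i
        simp only [Finset.mem_filter, Finset.mem_univ, true_and]
        constructor
        · intro h
          have h3 : ((p ^ e : ℕ) : ℤ) * d i = ((p ^ e : ℕ) : ℤ) * d i0 := by linarith
          have h4 : ((p ^ e : ℕ) : ℤ) ≠ 0 := by
            rw [← hq]; exact_mod_cast hq0.ne'
          exact_mod_cast mul_left_cancel₀ h4 h3
        · intro h
          rw [h]; exact hi0
      rw [h2, ← hd.2 (d i0)]
      have h3 := soc_lower p e w hw I (d i0)
      have h4 : p ^ e * d i0 + (p ^ e - 1) * ∑ i, w i = D + ∑ i, (p ^ e - 1) * df i := by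
        rw [← Finset.mul_sum]
        have h5 : 1 ≤ p ^ e := by rw [← hq]; exact hq0
        zify [h5]
        rw [haeq] at hi0
        push_cast at hi0
        linarith
      rw [h4] at h3
      exact h3
    · have h2 : (univ.filter fun i => ((p ^ e : ℕ) : ℤ) * d i - (((p ^ e : ℕ) : ℤ) - 1) * a = (D : ℤ)) = ∅ := by
        rw [Finset.filter_eq_empty_iff]
        intro i _ h
        exact hex ⟨i, h⟩
      rw [h2, Finset.card_empty]
      exact Nat.zero_le _
  have hinj := inj_main p e w hw f df hdf hf I hI hfI hIprim hdim
  have hB := lemB f (p ^ e) (hq ▸ hq0) (frobPow I (p ^ e))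
    (fun i => Ideal.subset_span ⟨_, hfI i, rfl⟩) hinj
  exact tor_one_subsingleton _ _ (tor_inj p e _ I f rfl hCI hB)
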